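/- arXiv:2111.06480 — 2 statements merged into one kernel-verified Lean document; each statement's English description precedes it below -/
import Mathlib

section
/- Let Z ⊂ X be a zero-dimensional closed subscheme, let i ∈ {1,…,k}, and let (a_1,…,a_k) ∈ ℕ^k. Then lim_{t→+∞} h^1(X, I_Z((a_1,…,a_k) + t·ε_i)) > 0 (this limit exists since the sequence is non-increasing) if and only if there exists a point p ∈ ℙ^{n_i} such that h^1(X, I_{π_i^{-1}(p) ∩ Z}(a_1,…,a_k)) > 0. -/
/-!
Core framework: a concrete algebraic model of the multiprojective space
`X = ℙ^{n 0} × ⋯ × ℙ^{n (k-1)}` over a field `K`, via its multihomogeneous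
coordinate ring `R = K[x_{ij}]`.
-/

open MvPolynomial Module
open scoped TensorProduct

namespace MultiProjPaper

variable (K : Type) [Field K] (k : ℕ) (n : Fin k → ℕ)

/-- Index type of the variables `x_{ij}`, `i = 1, …, k`, `0 ≤ j ≤ n i`. -/
abbrev MPIdx := Σ i : Fin k, Fin (n i + 1)

/-- The multihomogeneous coordinate ring `R = K[x_{ij}]` of the multiprojective space. -/
abbrev MPR := MvPolynomial (MPIdx k n) K

/-- The weight of the variable `x_{ij}` is the multiindex `ε_i`. -/
def mpWeight : MPIdx k n → (Fin k → ℕ) := fun x => Pi.single x.1 1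

/-- The space of multihomogeneous polynomials of multidegree `a`, i.e. `H^0(X, O_X(a))`. -/
noncomputable def mcomp (a : Fin k → ℕ) : Submodule K (MPR K k n) :=
  weightedHomogeneousSubmodule K (mpWeight k n) a

/-- A (representative of a) point of `X`: a tuple of nonzero vectors. -/
structure MPPoint where
  v : ∀ i : Fin k, Fin (n i + 1) → K
  nz : ∀ i, v i ≠ 0

/-- Evaluation of a polynomial at (a representative of) a point. -/
noncomputable def MPPoint.ev (P : MPPoint K k n) (f : MPR K k n) : K :=
  MvPolynomial.eval (fun x : MPIdx k n => P.v x.1 x.2) f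

/-- Evaluation at a scaling (by `lam i` on the `i`-th group of variables) of a point. -/
noncomputable def coneEval (lam : Fin k → K) (P : MPPoint K k n) (f : MPR K k n) : K :=
  MvPolynomial.eval (fun x : MPIdx k n => lam x.1 * P.v x.1 x.2) f

/-- The (multihomogeneous, saturated) vanishing ideal of a set of points of `X`:
all polynomials vanishing on the affine multicone over the set. -/
noncomputable def vanIdeal (S : Set (MPPoint K k n)) : Ideal (MPR K k n) where
  carrier := {f | ∀ P ∈ S, ∀ lam : Fin k → K, coneEval K k n lam P f = 0}
  add_mem' := by
    intro f g hf hg P hP lam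
    simp only [coneEval, map_add] at *
    rw [hf P hP lam, hg P hP lam, add_zero]
  zero_mem' := by intro P hP lam; simp [coneEval]
  smul_mem' := by
    intro c f hf P hP lam
    simp only [coneEval, smul_eq_mul, map_mul] at *
    rw [hf P hP lam, mul_zero]

/-- `H^0(X, 𝓘(a))` for the sheaf of ideals associated to a multihomogeneous ideal `I`:
the multidegree-`a` component of `I`. -/
noncomputable def secI (I : Ideal (MPR K k n)) (a : Fin k → ℕ) : Submodule K (MPR K k n) :=
  mcomp K k n a ⊓ (Submodule.restrictScalars K I)

/-- `h^0(X, 𝓘(a))`. -/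
noncomputable def h0I (I : Ideal (MPR K k n)) (a : Fin k → ℕ) : ℕ :=
  finrank K ↥(secI K k n I a)

/-- A zero-dimensional closed subscheme `Z ⊂ X`, modeled by its saturated multihomogeneous
ideal `I`, together with its degree (= length) `deg`: the multigraded Hilbert function of
`R/I` is eventually constant, equal to `deg`. -/
structure ZeroDimClosed where
  I : Ideal (MPR K k n)
  homog : ∀ f ∈ I, ∀ a : Fin k → ℕ, weightedHomogeneousComponent (mpWeight k n) a f ∈ I
  saturated : ∀ f : MPR K k n,
    (∀ g : ∀ i : Fin k, Fin (n i + 1), (∏ i : Fin k, X (⟨i, g i⟩ : MPIdx k n)) * f ∈ I) → f ∈ I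
  deg : ℕ
  hilb : ∃ d₀ : ℕ, ∀ a : Fin k → ℕ, (∀ i, d₀ ≤ a i) →
    finrank K ↥(secI K k n I a) + deg = finrank K ↥(mcomp K k n a)

/-- `h^0(X, 𝓘_Z(a))` for a zero-dimensional closed subscheme `Z`. -/
noncomputable def h0Z (Z : ZeroDimClosed K k n) (a : Fin k → ℕ) : ℕ := h0I K k n Z.I a

/-- `h^1(X, 𝓘_Z(a))` for a zero-dimensional closed subscheme `Z` and `a ∈ ℕ^k`:
from the exact sequence `0 → 𝓘_Z(a) → O_X(a) → O_Z(a) → 0` and `h^1(O_X(a)) = 0`,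
`h^1(𝓘_Z(a)) = deg Z - (h^0(O_X(a)) - h^0(𝓘_Z(a)))`. -/
noncomputable def h1Z (Z : ZeroDimClosed K k n) (a : Fin k → ℕ) : ℤ :=
  (Z.deg : ℤ) + (h0Z K k n Z a : ℤ) - (finrank K ↥(mcomp K k n a) : ℤ)

/-- "A general tuple of `s` points of `X` satisfies `P`": there is a nonzero polynomial `F`
in the coordinates of the representative vectors of the `s` points (i.e. a nonempty Zariski
open subset of `X^s`) such that every tuple of points where `F` does not vanish satisfies `P`. -/
def GenericPts (s : ℕ) (P : (Fin s → MPPoint K k n) → Prop) : Prop :=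
  ∃ F : MvPolynomial (Fin s × MPIdx k n) K, F ≠ 0 ∧
    ∀ T : Fin s → MPPoint K k n,
      MvPolynomial.eval (fun q : Fin s × MPIdx k n => (T q.1).v q.2.1 q.2.2) F ≠ 0 → P T

/-- "A general tuple of `d` vectors of the `K`-vector space `V` satisfies `P`":
there is a nonzero polynomial in the coordinates (w.r.t. a fixed basis) of the `d` vectors
such that every tuple where it does not vanish satisfies `P`. -/
def GenericVecs (V : Type) [AddCommGroup V] [Module K V] (d : ℕ)
    (P : (Fin d → V) → Prop) : Prop :=
  ∃ F : MvPolynomial (Fin d × (Basis.ofVectorSpaceIndex K V)) K, F ≠ 0 ∧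
    ∀ w : Fin d → V,
      MvPolynomial.eval
        (fun q : Fin d × (Basis.ofVectorSpaceIndex K V) =>
          (Basis.ofVectorSpace K V).repr (w q.1) q.2) F ≠ 0 → P w

/-- Multiplication `H^0(O_X(c)) ⊗ H^0(𝓘(a)) → H^0(𝓘(a + c))` as a bilinear map. -/
noncomputable def mulSec (I : Ideal (MPR K k n)) (c a : Fin k → ℕ) :
    ↥(mcomp K k n c) →ₗ[K] ↥(secI K k n I a) →ₗ[K] ↥(secI K k n I (a + c)) :=
  LinearMap.mk₂ K
    (fun f g => ⟨(f : MPR K k n) * (g : MPR K k n), by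
      constructor
      · have hf : IsWeightedHomogeneous (mpWeight k n) (f : MPR K k n) c := f.2
        have hg : IsWeightedHomogeneous (mpWeight k n) (g : MPR K k n) a := g.2.1
        have := hf.mul hg
        rw [add_comm c a] at this
        exact this
      · exact Ideal.mul_mem_left _ _ g.2.2⟩)
    (fun f f' g => by apply Subtype.ext; simp [add_mul])
    (fun c' f g => by apply Subtype.ext; simp [smul_eq_mul]; try ring)
    (fun f g g' => by apply Subtype.ext; simp [mul_add])
    (fun c' f g => by apply Subtype.ext; simp [smul_eq_mul]; try ring)

/-- The multiplication map `μ : H^0(O_X(c)) ⊗ H^0(𝓘(a)) → H^0(𝓘(a+c))`. -/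
noncomputable def mulMap (I : Ideal (MPR K k n)) (c a : Fin k → ℕ) :
    (↥(mcomp K k n c) ⊗[K] ↥(secI K k n I a)) →ₗ[K] ↥(secI K k n I (a + c)) :=
  TensorProduct.lift (mulSec K k n I c a)

end MultiProjPaper

namespace MultiProjPaper

variable (K : Type) [Field K] (k : ℕ) (n : Fin k → ℕ)

/-- The ideal of the fiber `π_i⁻¹(p)` of the `i`-th projection over a point
`p ∈ ℙ^{n_i}` (given by a nonzero coordinate vector). -/
noncomputable def fiberIdeal (i : Fin k) (p : Fin (n i + 1) → K) : Ideal (MPR K k n) :=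
  Ideal.span {f | ∃ c : Fin (n i + 1) → K, (∑ j, c j * p j) = 0 ∧
    f = ∑ j, (c j) • X (⟨i, j⟩ : MPIdx k n)}

/-- Saturation of a multihomogeneous ideal with respect to the irrelevant ideal of
the multiprojective space (generated by the products of one variable from each group). -/
noncomputable def msat (J : Ideal (MPR K k n)) : Ideal (MPR K k n) :=
  Ideal.span {f | ∃ N : ℕ, ∀ g : Fin N → ∀ i : Fin k, Fin (n i + 1),
    (∏ t : Fin N, ∏ i : Fin k, X (⟨i, g t i⟩ : MPIdx k n)) * f ∈ J}


variable {K k n}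

theorem weight_mpWeight (d : MPIdx k n →₀ ℕ) (j : Fin k) :
    Finsupp.weight (mpWeight k n) d j = ∑ m, d ⟨j, m⟩ := by
  classical
  rw [Finsupp.weight_apply, Finsupp.sum_fintype _ _ (by simp), Finset.sum_apply,
    Fintype.sum_sigma, Finset.sum_eq_single j]
  · simp [mpWeight]
  · intro b _ hb
    simp [mpWeight, Pi.single_eq_of_ne hb.symm]
  · simp

instance finite_mcomp (a : Fin k → ℕ) : Module.Finite K (mcomp K k n a) := by
  have hfin : {d : MPIdx k n →₀ ℕ | Finsupp.weight (mpWeight k n) d = a}.Finite := by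
    refine (Set.finite_Iic (Finsupp.equivFunOnFinite.symm fun x : MPIdx k n => a x.1)).subset ?_
    rintro d rfl ⟨j, m⟩
    simpa [weight_mpWeight] using
      Finset.single_le_sum (f := fun m => d ⟨j, m⟩) (fun _ _ => Nat.zero_le _) (Finset.mem_univ m)
  rw [mcomp, weightedHomogeneousSubmodule_eq_finsupp_supported]
  have := hfin.to_subtype
  exact Module.Finite.equiv (AddMonoidAlgebra.supportedEquivFinsupp (R := K) (S := K) _).symm

/-- The linear form `∑ j, c j * x_{ij}` in the `i`-th group of variables. -/
noncomputable def linForm (i : Fin k) (c : Fin (n i + 1) → K) : MPR K k n :=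
  ∑ j, c j • X (⟨i, j⟩ : MPIdx k n)

theorem X_mem_mcomp (i : Fin k) (j : Fin (n i + 1)) :
    (X (⟨i, j⟩ : MPIdx k n) : MPR K k n) ∈ mcomp K k n (Pi.single i 1) :=
  isWeightedHomogeneous_X K (mpWeight k n) _

theorem linForm_mem_mcomp (i : Fin k) (c : Fin (n i + 1) → K) :
    linForm i c ∈ mcomp K k n (Pi.single i 1) :=
  Submodule.sum_mem _ fun j _ => Submodule.smul_mem _ _ (X_mem_mcomp i j)

theorem mul_mem_mcomp {a b : Fin k → ℕ} {f g : MPR K k n} (hf : f ∈ mcomp K k n a)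
    (hg : g ∈ mcomp K k n b) : f * g ∈ mcomp K k n (a + b) :=
  IsWeightedHomogeneous.mul hf hg

theorem prod_pow_linForm_mem_mcomp (c : ∀ i, Fin (n i + 1) → K) (b : Fin k → ℕ) :
    ∏ i, linForm i (c i) ^ b i ∈ mcomp K k n b := by
  have h := IsWeightedHomogeneous.prod (w := mpWeight k n) Finset.univ
    (fun i => linForm i (c i) ^ b i) (fun i => b i • Pi.single i 1)
    fun i _ => IsWeightedHomogeneous.pow (linForm_mem_mcomp i (c i)) (b i)
  have e : ∑ i, b i • (Pi.single i 1 : Fin k → ℕ) = b := by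
    simp_rw [← Pi.single_smul, smul_eq_mul, mul_one]
    exact Finset.univ_sum_single b
  rwa [e] at h

/-- The image of the multidegree `a` component in the affine coordinate ring `R ⧸ J`. -/
noncomputable def compImage (J : Ideal (MPR K k n)) (a : Fin k → ℕ) : Submodule K (MPR K k n ⧸ J) :=
  (mcomp K k n a).map (Ideal.Quotient.mkₐ K J).toLinearMap

instance finite_compImage (J : Ideal (MPR K k n)) (a : Fin k → ℕ) :
    Module.Finite K (compImage J a) :=
  inferInstanceAs (Module.Finite K (Submodule.map _ _))

theorem mk_mem_compImage {J : Ideal (MPR K k n)} {a : Fin k → ℕ} {f : MPR K k n}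
    (hf : f ∈ mcomp K k n a) : Ideal.Quotient.mk J f ∈ compImage J a :=
  ⟨f, hf, rfl⟩

/-- `J` is the ideal of the affine chart, where the linear forms with coefficients `c` are `1`,
of the closed subscheme defined by `I`. -/
structure IsAffineChart (I J : Ideal (MPR K k n)) (c : ∀ i, Fin (n i + 1) → K) : Prop where
  mem_iff : ∀ (a : Fin k → ℕ) (f), f ∈ mcomp K k n a → (f ∈ J ↔ f ∈ I)
  linForm_sub_one_mem : ∀ i, linForm i (c i) - 1 ∈ J

namespace IsAffineChart

variable {I J : Ideal (MPR K k n)} {c : ∀ i, Fin (n i + 1) → K}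

theorem mk_linForm (h : IsAffineChart I J c) (i : Fin k) :
    Ideal.Quotient.mk J (linForm i (c i)) = 1 := by
  rw [← map_one (Ideal.Quotient.mk J)]
  exact Ideal.Quotient.eq.mpr (h.linForm_sub_one_mem i)

theorem compImage_mono (h : IsAffineChart I J c) : Monotone (compImage J) := by
  rintro a b hab _ ⟨f, hf, rfl⟩
  obtain ⟨b, rfl⟩ := exists_add_of_le hab
  refine ⟨f * ∏ i, linForm i (c i) ^ b i, mul_mem_mcomp hf (prod_pow_linForm_mem_mcomp c b), ?_⟩
  simp [h.mk_linForm]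

theorem finrank_add (h : IsAffineChart I J c) (a : Fin k → ℕ) :
    finrank K (compImage J a) + finrank K (secI K k n I a) = finrank K (mcomp K k n a) := by
  let φ := (Ideal.Quotient.mkₐ K J).toLinearMap.domRestrict (mcomp K k n a)
  have hr : LinearMap.range φ = compImage J a := by
    rw [LinearMap.range_domRestrict]; rfl
  have hk : (LinearMap.ker φ).map (mcomp K k n a).subtype = secI K k n I a := by
    ext f
    constructor
    · rintro ⟨f, hf, rfl⟩
      exact ⟨f.2, (h.mem_iff a f f.2).mp (Ideal.Quotient.eq_zero_iff_mem.mp hf)⟩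
    · rintro ⟨hf, hI⟩
      exact ⟨⟨f, hf⟩, Ideal.Quotient.eq_zero_iff_mem.mpr ((h.mem_iff a f hf).mpr hI), rfl⟩
  rw [← hr, ← hk, Submodule.finrank_map_subtype_eq, LinearMap.finrank_range_add_finrank_ker]

/-- Every class in `R ⧸ J` is represented in all sufficiently high multidegrees. -/
theorem exists_mem_compImage (h : IsAffineChart I J c) (s : MPR K k n ⧸ J) :
    ∃ a, ∀ b, a ≤ b → s ∈ compImage J b := by
  obtain ⟨f, rfl⟩ := Ideal.Quotient.mk_surjective s
  induction f using MvPolynomial.induction_on' with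
  | monomial d r =>
    exact ⟨_, fun b hb => h.compImage_mono hb
      (mk_mem_compImage (isWeightedHomogeneous_monomial (mpWeight k n) d r rfl))⟩
  | add f g hf hg =>
    obtain ⟨a, ha⟩ := hf
    obtain ⟨b, hb⟩ := hg
    refine ⟨a ⊔ b, fun e he => ?_⟩
    rw [map_add]
    exact add_mem (ha e (le_sup_left.trans he)) (hb e (le_sup_right.trans he))

variable {Z : ZeroDimClosed K k n}

theorem exists_compImage_eq_top (h : IsAffineChart Z.I J c) :
    ∃ d : ℕ, ∀ a : Fin k → ℕ, (∀ i, d ≤ a i) → compImage J a = ⊤ := by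
  obtain ⟨d, hd⟩ := Z.hilb
  have key (a : Fin k → ℕ) (ha : ∀ i, d ≤ a i) : finrank K (compImage J a) = Z.deg := by
    have := hd a ha
    have := h.finrank_add a
    omega
  refine ⟨d, fun a ha => eq_top_iff.mpr fun s _ => ?_⟩
  obtain ⟨b, hb⟩ := h.exists_mem_compImage s
  rw [Submodule.eq_of_le_of_finrank_eq (h.compImage_mono (le_sup_left : a ≤ a ⊔ b))
    ((key a ha).trans (key _ fun i => (ha i).trans le_sup_left).symm)]
  exact hb _ le_sup_right

theorem finite_quotient (h : IsAffineChart Z.I J c) : Module.Finite K (MPR K k n ⧸ J) := by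
  obtain ⟨d, hd⟩ := h.exists_compImage_eq_top
  have := finite_compImage J fun _ => d
  rw [hd _ fun _ => le_rfl] at this
  exact Module.finite_def.mpr (Module.Finite.iff_fg.mp this)

theorem finrank_quotient (h : IsAffineChart Z.I J c) : finrank K (MPR K k n ⧸ J) = Z.deg := by
  obtain ⟨d, hd⟩ := h.exists_compImage_eq_top
  obtain ⟨e, he⟩ := Z.hilb
  have h₁ := hd (fun _ => d ⊔ e) fun _ => le_sup_left
  have h₂ := he (fun _ => d ⊔ e) fun _ => le_sup_right
  have h₃ := h.finrank_add fun _ => d ⊔ e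
  rw [h₁, finrank_top] at h₃
  omega

theorem h1Z_pos_iff (h : IsAffineChart Z.I J c) (a : Fin k → ℕ) :
    0 < h1Z K k n Z a ↔ compImage J a ≠ ⊤ := by
  have := h.finite_quotient
  have h₁ := h.finrank_add a
  have h₂ := h.finrank_quotient
  have h₃ : compImage J a ≠ ⊤ ↔ finrank K (compImage J a) < finrank K (MPR K k n ⧸ J) :=
    ⟨fun ht => Submodule.finrank_lt ht, fun hlt ht => by rw [ht, finrank_top] at hlt; omega⟩
  rw [h₃, h1Z, h0Z, h0I]
  omega

end IsAffineChart

/-- Over an infinite field, a saturated ideal admits a linear form in each group of variables which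
is not a zero divisor modulo the ideal and does not vanish at a given point. -/
theorem exists_linForm_regular [Infinite K] (I : Ideal (MPR K k n))
    (hI : ∀ f : MPR K k n,
      (∀ g : ∀ i : Fin k, Fin (n i + 1), (∏ i : Fin k, X (⟨i, g i⟩ : MPIdx k n)) * f ∈ I) → f ∈ I)
    (i : Fin k) (p : Fin (n i + 1) → K) (hp : p ≠ 0) :
    ∃ c : Fin (n i + 1) → K, ∑ j, c j * p j = 1 ∧ ∀ f, linForm i c * f ∈ I → f ∈ I := by
  classical
  let L : (Fin (n i + 1) → K) →ₗ[K] MPR K k n := Fintype.linearCombination K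
    fun j => X (⟨i, j⟩ : MPIdx k n)
  have hL (c) : L c = linForm i c := Fintype.linearCombination_apply ..
  let e : (Fin (n i + 1) → K) →ₗ[K] K := Fintype.linearCombination K p
  have he (c) : e c = ∑ j, c j * p j := Fintype.linearCombination_apply ..
  let A := associatedPrimes (MPR K k n) (MPR K k n ⧸ I)
  have hA : A.Finite := associatedPrimes.finite _ _
  let s : Finset (Subspace K (Fin (n i + 1) → K)) :=
    insert (LinearMap.ker e) (hA.toFinset.image fun P => (P.restrictScalars K).comap L)
  have hs : ⊤ ∉ s := by
    simp only [s, Finset.mem_insert, Finset.mem_image, Set.Finite.mem_toFinset, not_or, not_exists,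
      not_and]
    constructor
    · intro h
      obtain ⟨j, hj⟩ := Function.ne_iff.mp hp
      have : e (Pi.single j 1) = 0 := LinearMap.mem_ker.mp (h ▸ Submodule.mem_top)
      rw [he] at this
      simp [Pi.single_apply] at this
      exact hj this
    · intro P hP h
      have hX (j) : (X ⟨i, j⟩ : MPR K k n) ∈ P := by
        have : L (Pi.single j 1) ∈ P := by
          have := (h ▸ Submodule.mem_top :
            (Pi.single j 1 : Fin (n i + 1) → K) ∈ (P.restrictScalars K).comap L)
          exact this
        simpa [L, Fintype.linearCombination_apply, Pi.single_apply] using this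
      obtain ⟨hprime, x, rfl⟩ := isAssociatedPrime_iff.mp hP
      obtain ⟨f, rfl⟩ := Ideal.Quotient.mk_surjective x
      have hmem (r : MPR K k n) :
          r ∈ Submodule.colon (⊥ : Submodule (MPR K k n) (MPR K k n ⧸ I))
            {Ideal.Quotient.mk I f} ↔ r * f ∈ I := by
        rw [Submodule.mem_colon_singleton, Submodule.mem_bot, ← Ideal.Quotient.eq_zero_iff_mem]
        rfl
      refine hprime.ne_top ((Ideal.eq_top_iff_one _).mpr ((hmem 1).mpr ?_))
      rw [one_mul]
      refine hI f fun g => (hmem _).mp ?_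
      exact Ideal.mem_of_dvd _ (Finset.dvd_prod_of_mem _ (Finset.mem_univ i)) (hX (g i))
  obtain ⟨c, hc⟩ := (Set.ne_univ_iff_exists_notMem _).mp (Subspace.biUnion_ne_univ_of_top_notMem hs)
  simp only [s, Finset.mem_insert, Finset.mem_image, Set.Finite.mem_toFinset, Set.mem_iUnion,
    not_exists, SetLike.mem_coe] at hc
  have hce : e c ≠ 0 := fun h => hc _ (Or.inl rfl) h
  have hcP : ∀ P ∈ A, linForm i c ∉ P := fun P hP h =>
    hc _ (Or.inr ⟨P, hP, rfl⟩) (by simpa [hL] using h)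
  have hreg : ∀ f, linForm i c * f ∈ I → f ∈ I := by
    intro f hf
    by_contra hfI
    have : linForm i c ∈ ⋃ P ∈ A, (P : Set (MPR K k n)) := by
      rw [biUnion_associatedPrimes_eq_zero_divisors]
      refine ⟨Ideal.Quotient.mk I f, fun h => hfI (Ideal.Quotient.eq_zero_iff_mem.mp h), ?_⟩
      exact Ideal.Quotient.eq_zero_iff_mem.mpr hf
    simp only [Set.mem_iUnion] at this
    obtain ⟨P, hP, h⟩ := this
    exact hcP P hP h
  refine ⟨(e c)⁻¹ • c, ?_, fun f hf => hreg f ?_⟩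
  · rw [← he, map_smul, smul_eq_mul, inv_mul_cancel₀ hce]
  · rw [← hL, map_smul, smul_mul_assoc, hL] at hf
    have := (I.restrictScalars K).smul_mem (e c) hf
    rwa [smul_inv_smul₀ hce] at this

theorem exists_isAffineChart [Infinite K] (I : Ideal (MPR K k n))
    (hI : ∀ f : MPR K k n,
      (∀ g : ∀ i : Fin k, Fin (n i + 1), (∏ i : Fin k, X (⟨i, g i⟩ : MPIdx k n)) * f ∈ I) → f ∈ I)
    (p : ∀ i, Fin (n i + 1) → K) (hp : ∀ i, p i ≠ 0) :
    ∃ (c : ∀ i, Fin (n i + 1) → K) (J : Ideal (MPR K k n)), IsAffineChart I J c ∧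
      ∀ i, ∑ j, c i j * p i j = 1 := by
  choose c hcp hc using fun i => exists_linForm_regular I hI i (p i) (hp i)
  let F := FractionRing (MPR K k n ⧸ I)
  let ι : MPR K k n →ₐ[K] F := (IsScalarTower.toAlgHom K (MPR K k n ⧸ I) F).comp
    (Ideal.Quotient.mkₐ K I)
  have hι (f) : ι f = 0 ↔ f ∈ I := by
    rw [← Ideal.Quotient.eq_zero_iff_mem]
    exact map_eq_zero_iff _ (IsFractionRing.injective (MPR K k n ⧸ I) F)
  have hunit (i) : IsUnit (ι (linForm i (c i))) := by
    refine IsLocalization.map_units F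
      (⟨Ideal.Quotient.mk I (linForm i (c i)), ?_⟩ : nonZeroDivisors (MPR K k n ⧸ I))
    rw [mem_nonZeroDivisors_iff_left]
    intro x hx
    obtain ⟨f, rfl⟩ := Ideal.Quotient.mk_surjective x
    rw [← map_mul, Ideal.Quotient.eq_zero_iff_mem] at hx
    exact Ideal.Quotient.eq_zero_iff_mem.mpr (hc i f hx)
  choose u hu using fun i => (hunit i).exists_right_inv
  let φ : MPR K k n →ₐ[K] F := aeval fun x : MPIdx k n => ι (X x) * u x.1
  have hφ (a : Fin k → ℕ) (f) (hf : f ∈ mcomp K k n a) : φ f = ι f * ∏ i, u i ^ a i := by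
    refine IsWeightedHomogeneous.induction_on (w := mpWeight k n)
      (motive := fun f _ => φ f = ι f * ∏ i, u i ^ a i) (by simp) ?_ ?_ hf
    · intro f g _ _ h₁ h₂
      rw [map_add, map_add, h₁, h₂, add_mul]
    · rintro d r rfl
      have hd : ∏ x, u x.1 ^ d x = ∏ i, u i ^ Finsupp.weight (mpWeight k n) d i := by
        simp_rw [Fintype.prod_sigma, weight_mpWeight, Finset.prod_pow_eq_pow_sum]
      rw [← hd, monomial_eq, Finsupp.prod_fintype _ _ (by simp)]
      simp only [map_mul, map_prod, map_pow, φ, aeval_X, mul_pow, Finset.prod_mul_distrib,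
        ← algebraMap_eq, AlgHom.commutes, mul_assoc]
  refine ⟨c, RingHom.ker φ, ⟨fun a f hf => ?_, fun i => ?_⟩, hcp⟩
  · have hun : IsUnit (∏ i, u i ^ a i) := by
      refine IsUnit.prod_univ_iff.mpr fun i => IsUnit.pow _ ?_
      exact IsUnit.of_mul_eq_one_right _ (hu i)
    rw [RingHom.mem_ker, hφ a f hf, hun.mul_left_eq_zero, hι]
  · have : ∏ j, u j ^ (Pi.single i 1 : Fin k → ℕ) j = u i := by
      rw [Finset.prod_eq_single i] <;> simp +contextual
    rw [RingHom.mem_ker, map_sub, map_one, hφ _ _ (linForm_mem_mcomp i (c i)), this, hu, sub_self]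

section Fiber

attribute [local instance] MvPolynomial.weightedGradedAlgebra

/-- The largest multihomogeneous ideal contained in `J`. -/
noncomputable def homogPart (J : Ideal (MPR K k n)) : Ideal (MPR K k n) :=
  (J.homogeneousCore (weightedHomogeneousSubmodule K (mpWeight k n))).toIdeal

theorem mem_homogPart_of_mem_mcomp {J : Ideal (MPR K k n)} {a : Fin k → ℕ} {f : MPR K k n}
    (hf : f ∈ mcomp K k n a) : f ∈ homogPart J ↔ f ∈ J :=
  ⟨fun h => Ideal.toIdeal_homogeneousCore_le _ J h,
    fun h => Ideal.mem_homogeneousCore_of_homogeneous_of_mem ⟨a, hf⟩ h⟩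

theorem mem_homogPart_iff {J : Ideal (MPR K k n)} {f : MPR K k n} :
    f ∈ homogPart J ↔ ∀ a, weightedHomogeneousComponent (mpWeight k n) a f ∈ J := by
  rw [homogPart, mem_iff_weightedHomogeneousComponent_mem K (mpWeight k n)
    (HomogeneousIdeal.isHomogeneous _)]
  exact forall_congr' fun a =>
    mem_homogPart_of_mem_mcomp (weightedHomogeneousComponent_mem (mpWeight k n) f a)

theorem weightedHomogeneousComponent_add_mul {a : Fin k → ℕ} {q : MPR K k n}
    (hq : q ∈ mcomp K k n a) (b : Fin k → ℕ) (f : MPR K k n) :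
    weightedHomogeneousComponent (mpWeight k n) (a + b) (q * f) =
      q * weightedHomogeneousComponent (mpWeight k n) b f := by
  have := DirectSum.coe_decompose_mul_add_of_left_mem
    (weightedHomogeneousSubmodule K (mpWeight k n)) (j := b) (b := f) hq
  rw [← weightedDecomposition.decompose'_apply, ← weightedDecomposition.decompose'_apply]
  exact this

theorem mem_homogPart_of_mul_mem {J : Ideal (MPR K k n)} {a : Fin k → ℕ} {q f : MPR K k n}
    (hq : q ∈ mcomp K k n a) (hqJ : q - 1 ∈ J) (h : q * f ∈ homogPart J) : f ∈ homogPart J := by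
  rw [mem_homogPart_iff] at h ⊢
  intro b
  have h₁ := h (a + b)
  rw [weightedHomogeneousComponent_add_mul hq] at h₁
  have h₂ := J.mul_mem_right (weightedHomogeneousComponent (mpWeight k n) b f) hqJ
  have := J.sub_mem h₁ h₂
  rwa [← sub_mul, sub_sub_cancel, one_mul] at this

end Fiber

theorem prod_linForm_pow_mul_mem {I : Ideal (MPR K k n)} (c : ∀ i, Fin (n i + 1) → K) {N : ℕ}
    {f : MPR K k n}
    (h : ∀ g : Fin N → ∀ i : Fin k, Fin (n i + 1),
      (∏ t : Fin N, ∏ i : Fin k, X (⟨i, g t i⟩ : MPIdx k n)) * f ∈ I) :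
    (∏ i, linForm i (c i)) ^ N * f ∈ I := by
  rw [← Fin.prod_const]
  simp_rw [linForm, Finset.prod_univ_sum, Finset.sum_mul]
  refine I.sum_mem fun g _ => ?_
  simp_rw [smul_eq_C_mul, Finset.prod_mul_distrib, mul_assoc]
  exact I.mul_mem_left _ (h g)

/-- The ideal of the fiber over the point `p` of the `i`-th factor in an affine chart. -/
noncomputable def fiberChart (J : Ideal (MPR K k n)) (i : Fin k) (p : Fin (n i + 1) → K) :
    Ideal (MPR K k n) :=
  J ⊔ Ideal.span (Set.range fun j => X ⟨i, j⟩ - C (p j))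

theorem mem_fiberChart {J : Ideal (MPR K k n)} {i : Fin k} {p : Fin (n i + 1) → K}
    {f : MPR K k n} : f ∈ fiberChart J i p ↔ ∃ h : Fin (n i + 1) → MPR K k n,
      f - ∑ j, h j * (X ⟨i, j⟩ - C (p j)) ∈ J := by
  rw [fiberChart, Submodule.mem_sup]
  constructor
  · rintro ⟨g, hg, s, hs, rfl⟩
    obtain ⟨h, rfl⟩ := (Submodule.mem_span_range_iff_exists_fun _).mp hs
    exact ⟨h, by simpa using hg⟩
  · rintro ⟨h, hh⟩
    exact ⟨_, hh, _, Submodule.sum_mem _ fun j _ =>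
      Ideal.mul_mem_left _ _ (Ideal.subset_span ⟨j, rfl⟩), sub_add_cancel _ _⟩

theorem mk_X_fiberChart (J : Ideal (MPR K k n)) (i : Fin k) (p : Fin (n i + 1) → K)
    (j : Fin (n i + 1)) :
    Ideal.Quotient.mk (fiberChart J i p) (X ⟨i, j⟩) = Ideal.Quotient.mk _ (C (p j)) :=
  Ideal.Quotient.eq.mpr (Ideal.mem_sup_right (Ideal.subset_span ⟨j, rfl⟩))

theorem fiberIdeal_le_homogPart (J : Ideal (MPR K k n)) (i : Fin k) (p : Fin (n i + 1) → K) :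
    fiberIdeal K k n i p ≤ homogPart (fiberChart J i p) := by
  refine Ideal.span_le.mpr ?_
  rintro _ ⟨c, hc, rfl⟩
  refine (mem_homogPart_of_mem_mcomp (linForm_mem_mcomp i c)).mpr ?_
  rw [← Ideal.Quotient.eq_zero_iff_mem, linForm]
  simp_rw [smul_eq_C_mul, map_sum, map_mul, mk_X_fiberChart, ← map_mul, ← map_sum, hc, map_zero]

namespace IsAffineChart

variable {Z : ZeroDimClosed K k n} {J : Ideal (MPR K k n)} {c : ∀ i, Fin (n i + 1) → K}
  {i : Fin k} {p : Fin (n i + 1) → K}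

/-- In high multidegrees, membership in the ideal of the fiber can be tested in the chart. -/
theorem exists_mem_sup_fiberIdeal (h : IsAffineChart Z.I J c) (hp : ∑ j, c i j * p j = 1) :
    ∃ d : ℕ, ∀ b : Fin k → ℕ, (∀ l, d ≤ b l) → ∀ f ∈ mcomp K k n (b + Pi.single i 1),
      f ∈ fiberChart J i p → f ∈ Z.I ⊔ fiberIdeal K k n i p := by
  obtain ⟨d, hd⟩ := h.exists_compImage_eq_top
  refine ⟨d, fun b hb f hf hfJ => ?_⟩
  obtain ⟨s, hs⟩ := mem_fiberChart.mp hfJ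
  have hr (j) : Ideal.Quotient.mk J (s j) ∈ compImage J b := hd b hb ▸ Submodule.mem_top
  choose r hrm hr using hr
  replace hr : ∀ j, Ideal.Quotient.mk J (r j) = Ideal.Quotient.mk J (s j) := hr
  let v (j) : MPR K k n := linForm i (Pi.single j 1 - p j • c i)
  have hv (j) : v j = X ⟨i, j⟩ - C (p j) * linForm i (c i) := by
    simp [v, linForm, sub_smul, Pi.single_apply, Finset.sum_sub_distrib, mul_smul,
      Finset.mul_sum, smul_eq_C_mul]
  have hvI (j) : v j ∈ fiberIdeal K k n i p := by
    refine Ideal.subset_span ⟨_, ?_, rfl⟩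
    simp [sub_mul, Pi.single_apply, Finset.sum_sub_distrib, mul_assoc, ← Finset.mul_sum, hp]
  have hu : ∑ j, r j * v j ∈ mcomp K k n (b + Pi.single i 1) :=
    Submodule.sum_mem _ fun j _ => mul_mem_mcomp (hrm j) (linForm_mem_mcomp i _)
  have hfu : f - ∑ j, r j * v j ∈ J := by
    rw [← Ideal.Quotient.eq_zero_iff_mem] at hs ⊢
    rw [← hs]
    simp [hr, hv, h.mk_linForm]
  rw [← sub_add_cancel f (∑ j, r j * v j)]
  exact add_mem (Ideal.mem_sup_left ((h.mem_iff _ _ (sub_mem hf hu)).mp hfu))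
    (Ideal.mem_sup_right (sum_mem fun j _ => Ideal.mul_mem_left _ _ (hvI j)))

theorem prod_linForm_pow_sub_one_mem {I : Ideal (MPR K k n)} (h : IsAffineChart I J c) (N : ℕ) :
    (∏ i, linForm i (c i)) ^ N - 1 ∈ J := by
  rw [← Ideal.Quotient.eq_zero_iff_mem]
  simp [h.mk_linForm]

theorem mem_homogPart_of_forall {J' : Ideal (MPR K k n)} {I : Ideal (MPR K k n)}
    (h : IsAffineChart I J c) (hJ : J ≤ J') {N : ℕ} {f : MPR K k n}
    (hf : ∀ g : Fin N → ∀ i : Fin k, Fin (n i + 1),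
      (∏ t : Fin N, ∏ i : Fin k, X (⟨i, g t i⟩ : MPIdx k n)) * f ∈ homogPart J') :
    f ∈ homogPart J' := by
  have hm : (∏ i, linForm i (c i)) ^ N ∈ mcomp K k n fun _ => N := by
    rw [← Finset.prod_pow]
    exact prod_pow_linForm_mem_mcomp c fun _ => N
  exact mem_homogPart_of_mul_mem hm (hJ (h.prod_linForm_pow_sub_one_mem N))
    (prod_linForm_pow_mul_mem c hf)

theorem msat_sup_fiberIdeal (h : IsAffineChart Z.I J c) (hp : ∑ j, c i j * p j = 1) :
    msat K k n (Z.I ⊔ fiberIdeal K k n i p) = homogPart (fiberChart J i p) := by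
  have hJ : J ≤ fiberChart J i p := le_sup_left
  refine le_antisymm (Ideal.span_le.mpr ?_) (Ideal.span_le.mpr ?_)
  · rintro f ⟨N, hf⟩
    refine h.mem_homogPart_of_forall (N := N) hJ fun g => ?_
    refine sup_le (fun x hx => ?_) (fiberIdeal_le_homogPart J i p) (hf g)
    refine mem_homogPart_iff.mpr fun a => hJ ?_
    exact (h.mem_iff a _ (weightedHomogeneousComponent_mem _ x a)).mpr (Z.homog x hx a)
  · rintro _ ⟨⟨f, b, hfb⟩, hf, rfl⟩
    obtain ⟨d, hd⟩ := h.exists_mem_sup_fiberIdeal hp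
    refine Ideal.subset_span ⟨d + 1, fun g => ?_⟩
    refine hd ((fun _ => d + 1) + b - Pi.single i 1) (fun l => ?_) _ ?_
      (Ideal.mul_mem_left _ _ hf)
    · by_cases hl : l = i
      · subst hl; simp
      · simp [hl]; omega
    · rw [tsub_add_cancel_of_le]
      · refine mul_mem_mcomp ?_ hfb
        have := IsWeightedHomogeneous.prod (w := mpWeight k n) Finset.univ
          (fun t => ∏ i : Fin k, (X ⟨i, g t i⟩ : MPR K k n)) (fun _ => fun _ => 1) fun t _ => by
            have := IsWeightedHomogeneous.prod (w := mpWeight k n) Finset.univ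
              (fun i => (X ⟨i, g t i⟩ : MPR K k n)) (fun i => Pi.single i 1)
              fun i _ => X_mem_mcomp i (g t i)
            rwa [Finset.univ_sum_single (fun _ : Fin k => (1 : ℕ))] at this
        have e : ∑ _t : Fin (d + 1), (fun _ : Fin k => 1) = fun _ => d + 1 := by ext; simp
        rwa [e] at this
      · intro l
        by_cases hl : l = i
        · subst hl; simp; omega
        · simp [hl]

theorem fiber (h : IsAffineChart Z.I J c) (hp : ∑ j, c i j * p j = 1) :
    IsAffineChart (msat K k n (Z.I ⊔ fiberIdeal K k n i p)) (fiberChart J i p) c where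
  mem_iff a f hf := by rw [h.msat_sup_fiberIdeal hp, mem_homogPart_of_mem_mcomp hf]
  linForm_sub_one_mem i := Ideal.mem_sup_left (h.linForm_sub_one_mem i)

end IsAffineChart

theorem compImage_eq_top_of_le {J J' : Ideal (MPR K k n)} (hJ : J ≤ J') {b : Fin k → ℕ}
    (h : compImage J b = ⊤) : compImage J' b = ⊤ := by
  refine eq_top_iff.mpr fun s _ => ?_
  obtain ⟨f, rfl⟩ := Ideal.Quotient.mk_surjective s
  obtain ⟨g, hg, hgf⟩ : Ideal.Quotient.mk J f ∈ compImage J b := h ▸ Submodule.mem_top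
  exact ⟨g, hg, Ideal.Quotient.eq.mpr (hJ (Ideal.Quotient.eq.mp hgf))⟩

theorem compImage_fiberChart_add_le (J : Ideal (MPR K k n)) (i : Fin k) (p : Fin (n i + 1) → K)
    (b : Fin k → ℕ) :
    compImage (fiberChart J i p) (b + Pi.single i 1) ≤ compImage (fiberChart J i p) b := by
  rintro _ ⟨f, hf, rfl⟩
  refine IsWeightedHomogeneous.induction_on (w := mpWeight k n)
    (motive := fun f _ => Ideal.Quotient.mk (fiberChart J i p) f ∈ compImage (fiberChart J i p) b)
    (by simp) (fun f g _ _ hf hg => by rw [map_add]; exact add_mem hf hg) (fun d r hd => ?_) hf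
  obtain ⟨m, hm⟩ : ∃ m, d ⟨i, m⟩ ≠ 0 := by
    by_contra! h
    have := congrFun hd i
    simp [weight_mpWeight, h] at this
  obtain ⟨e, rfl⟩ : ∃ e, d = e + Finsupp.single ⟨i, m⟩ 1 :=
    ⟨_, (tsub_add_cancel_of_le (Finsupp.single_le_iff.mpr (Nat.one_le_iff_ne_zero.mpr hm))).symm⟩
  have he : Finsupp.weight (mpWeight k n) e = b := by
    rw [map_add, Finsupp.weight_single, one_smul] at hd
    exact add_right_cancel hd
  refine ⟨p m • monomial e r,
    Submodule.smul_mem _ _ (isWeightedHomogeneous_monomial (mpWeight k n) e r he), ?_⟩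
  change Ideal.Quotient.mk _ _ = _
  rw [smul_eq_C_mul, map_mul, ← mk_X_fiberChart, ← map_mul, mul_comm, X, monomial_mul, mul_one]

/-- A proper subspace of a finite-dimensional algebra over an algebraically closed field that is
stable under multiplication by a family of elements lies in a proper subspace modulo which these
elements act as scalars. -/
theorem exists_le_forall_mul_sub_smul_mem [IsAlgClosed K] {S : Type*} [CommRing S] [Algebra K S]
    [Module.Finite K S] {ι : Type*} (y : ι → S) (U : Submodule K S) (hU : U ≠ ⊤)
    (hy : ∀ j, ∀ s ∈ U, y j * s ∈ U) :
    ∃ (p : ι → K) (V : Submodule K S), U ≤ V ∧ V ≠ ⊤ ∧ ∀ j s, y j * s - p j • s ∈ V := by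
  obtain ⟨V, hUV, ⟨hV, hyV⟩, hmax⟩ := exists_maximal_ge_of_wellFoundedGT
    (fun V : Submodule K S => V ≠ ⊤ ∧ ∀ j, ∀ s ∈ V, y j * s ∈ V) U ⟨hU, hy⟩
  have : Nontrivial (S ⧸ V) := Submodule.Quotient.nontrivial_iff.mpr hV
  have key (j : ι) : ∃ q : K, ∀ s, y j * s - q • s ∈ V := by
    obtain ⟨q, hq⟩ := Module.End.exists_eigenvalue
      (V.mapQ V (LinearMap.mulLeft K (y j)) fun s hs => hyV j s hs)
    obtain ⟨v, hv⟩ := hq.exists_hasEigenvector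
    obtain ⟨s₀, rfl⟩ := Submodule.Quotient.mk_surjective V v
    let E : Submodule K S := V.comap (LinearMap.mulLeft K (y j) - q • LinearMap.id)
    have hE (s) : s ∈ E ↔ y j * s - q • s ∈ V := Iff.rfl
    have hVE : V ≤ E := fun s hs => sub_mem (hyV j s hs) (V.smul_mem q hs)
    have hs₀ : s₀ ∈ E := by
      rw [hE, ← Submodule.Quotient.eq]
      exact hv.apply_eq_smul
    have hs₀V : s₀ ∉ V := fun h => hv.2 ((Submodule.Quotient.mk_eq_zero V).mpr h)
    have htop : E = ⊤ := by
      by_contra hne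
      refine hs₀V (hmax ⟨hne, fun l s hs => ?_⟩ hVE hs₀)
      rw [hE] at hs ⊢
      have := hyV l _ hs
      rwa [mul_sub, mul_left_comm, mul_smul_comm] at this
    exact ⟨q, fun s => (hE s).mp (htop ▸ Submodule.mem_top)⟩
  choose p hp using key
  exact ⟨p, V, hUV, hV, hp⟩

/-- If no component `a + t ε_i` generates the affine coordinate ring, then some fiber of the `i`-th
projection is not generated in multidegree `a`. -/
theorem IsAffineChart.exists_fiberChart_ne_top [IsAlgClosed K] {Z : ZeroDimClosed K k n}
    {J : Ideal (MPR K k n)} {c : ∀ i, Fin (n i + 1) → K} (h : IsAffineChart Z.I J c) (i : Fin k)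
    (a : Fin k → ℕ) (ht : ∀ t : ℕ, compImage J (a + t • Pi.single i 1) ≠ ⊤) :
    ∃ p : Fin (n i + 1) → K, ∑ j, c i j * p j = 1 ∧ compImage (fiberChart J i p) a ≠ ⊤ := by
  have := h.finite_quotient
  let u : ℕ →o Submodule K (MPR K k n ⧸ J) :=
    ⟨fun t => compImage J (a + t • Pi.single i 1), fun s t hst => h.compImage_mono
      (add_le_add_right (nsmul_le_nsmul_left zero_le hst) a)⟩
  obtain ⟨t, hu⟩ := monotone_stabilizes_iff_noetherian.mpr
    (inferInstance : IsNoetherian K (MPR K k n ⧸ J)) u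
  have hstable : ∀ j, ∀ s ∈ u t, Ideal.Quotient.mk J (X ⟨i, j⟩) * s ∈ u t := by
    rintro j _ ⟨f, hf, rfl⟩
    rw [hu (t + 1) t.le_succ]
    have := mk_mem_compImage (J := J) (mul_mem_mcomp hf (X_mem_mcomp i j))
    rwa [add_assoc, ← succ_nsmul, mul_comm, map_mul] at this
  obtain ⟨p, V, hUV, hV, hp⟩ := exists_le_forall_mul_sub_smul_mem
    (fun j => Ideal.Quotient.mk J (X ⟨i, j⟩)) (u t) (ht t) hstable
  refine ⟨p, ?_, fun htop => hV (eq_top_iff.mpr fun s _ => ?_)⟩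
  · by_contra hne
    refine hV (eq_top_iff.mpr fun s _ => ?_)
    have hs : ∑ j, c i j • (Ideal.Quotient.mk J (X ⟨i, j⟩) * s - p j • s) ∈ V :=
      V.sum_mem fun j _ => V.smul_mem _ (hp j s)
    have h₁ : ∑ j, c i j • Ideal.Quotient.mk J (X ⟨i, j⟩) = 1 := by
      rw [← h.mk_linForm i, linForm, map_sum]
      rfl
    have h₂ : ∑ j, c i j • (Ideal.Quotient.mk J (X ⟨i, j⟩) * s - p j • s) =
        (1 - ∑ j, c i j * p j) • s := by
      simp_rw [smul_sub, Finset.sum_sub_distrib, ← smul_mul_assoc, ← Finset.sum_mul, h₁, one_mul,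
        smul_smul, ← Finset.sum_smul, sub_smul, one_smul]
    rw [h₂] at hs
    exact (V.smul_mem_iff (sub_ne_zero.mpr (Ne.symm hne))).mp hs
  · obtain ⟨f, rfl⟩ := Ideal.Quotient.mk_surjective s
    obtain ⟨g, hg, hgf⟩ : Ideal.Quotient.mk (fiberChart J i p) f ∈ compImage (fiberChart J i p) a :=
      htop ▸ Submodule.mem_top
    obtain ⟨r, hr⟩ := mem_fiberChart.mp (Ideal.Quotient.eq.mp hgf.symm)
    have hgV : Ideal.Quotient.mk J g ∈ V := by
      refine hUV (h.compImage_mono ?_ (mk_mem_compImage hg))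
      exact le_self_add
    have hrV : ∑ j, Ideal.Quotient.mk J (r j) * Ideal.Quotient.mk J (X ⟨i, j⟩ - C (p j)) ∈ V := by
      refine V.sum_mem fun j _ => ?_
      have := hp j (Ideal.Quotient.mk J (r j))
      rw [map_sub, mul_sub, mul_comm]
      convert this using 2
      rw [← map_mul, mul_comm, ← smul_eq_C_mul]
      rfl
    have e : Ideal.Quotient.mk J f = Ideal.Quotient.mk J g +
        ∑ j, Ideal.Quotient.mk J (r j) * Ideal.Quotient.mk J (X ⟨i, j⟩ - C (p j)) := by
      rw [← sub_eq_iff_eq_add', ← map_sub]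
      simp_rw [← map_mul, ← map_sum]
      exact Ideal.Quotient.eq.mpr hr
    rw [e]
    exact add_mem hgV hrV

/-- The zero-dimensional scheme `π_i⁻¹(p) ∩ Z`. -/
theorem IsAffineChart.exists_fiber {Z : ZeroDimClosed K k n} {J : Ideal (MPR K k n)}
    {c : ∀ i, Fin (n i + 1) → K} (h : IsAffineChart Z.I J c) {i : Fin k} {p : Fin (n i + 1) → K}
    (hp : ∑ j, c i j * p j = 1) :
    ∃ W : ZeroDimClosed K k n, W.I = msat K k n (Z.I ⊔ fiberIdeal K k n i p) := by
  have hI := h.msat_sup_fiberIdeal hp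
  have hJ : J ≤ fiberChart J i p := le_sup_left
  refine ⟨⟨msat K k n (Z.I ⊔ fiberIdeal K k n i p), fun f hf a => ?_, fun f hf => ?_,
    finrank K (MPR K k n ⧸ fiberChart J i p), ?_⟩, rfl⟩
  · rw [hI] at hf ⊢
    exact (mem_homogPart_of_mem_mcomp (weightedHomogeneousComponent_mem _ f a)).mpr
      (mem_homogPart_iff.mp hf a)
  · rw [hI] at hf ⊢
    exact h.mem_homogPart_of_forall (N := 1) hJ fun g => by simpa using hf (g 0)
  · obtain ⟨d, hd⟩ := h.exists_compImage_eq_top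
    refine ⟨d, fun a ha => ?_⟩
    have := (h.fiber hp).finrank_add a
    rwa [compImage_eq_top_of_le hJ (hd a ha), finrank_top, add_comm] at this

/-- Proposition `0bg1`(3).
`lim_{t→∞} h^1(X, 𝓘_Z(a + t ε_i)) > 0` (the sequence being non-increasing, this is
equivalent to all its terms being positive, which is how we state it) if and only if
there is a point `p ∈ ℙ^{n_i}` with `h^1(X, 𝓘_{π_i⁻¹(p) ∩ Z}(a)) > 0`, where the
scheme-theoretic intersection `π_i⁻¹(p) ∩ Z` is the zero-dimensional closed subscheme
whose saturated ideal is the saturation of `I_Z + I_{π_i⁻¹(p)}`. -/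
theorem statement2 (K : Type) [Field K] [IsAlgClosed K] [CharZero K]
    (k : ℕ) (n : Fin k → ℕ) (hn : ∀ i, 1 ≤ n i)
    (Z : ZeroDimClosed K k n) (i : Fin k) (a : Fin k → ℕ) :
    (∀ t : ℕ, 0 < h1Z K k n Z (a + t • Pi.single i 1)) ↔
    (∃ p : Fin (n i + 1) → K, p ≠ 0 ∧
      ∃ W : ZeroDimClosed K k n, W.I = msat K k n (Z.I ⊔ fiberIdeal K k n i p) ∧
        0 < h1Z K k n W a) := by
  constructor
  · intro h
    obtain ⟨c, J, hJ, -⟩ := exists_isAffineChart Z.I Z.saturated (fun _ => 1)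
      fun _ => one_ne_zero
    obtain ⟨p, hp, hne⟩ := hJ.exists_fiberChart_ne_top i a fun t => (hJ.h1Z_pos_iff _).mp (h t)
    obtain ⟨W, hW⟩ := hJ.exists_fiber hp
    refine ⟨p, ?_, W, hW, ?_⟩
    · rintro rfl
      simp at hp
    · have hfib := hJ.fiber hp
      rw [← hW] at hfib
      exact (hfib.h1Z_pos_iff a).mpr hne
  · rintro ⟨p, hp, W, hW, hpos⟩ t
    obtain ⟨c, J, hJ, hc⟩ := exists_isAffineChart Z.I Z.saturated
      (Function.update (fun _ => 1) i p) fun l => by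
        by_cases hl : l = i
        · subst hl
          simpa using hp
        · simp [hl]
    have hcp : ∑ j, c i j * p j = 1 := by simpa using hc i
    have hfib := hJ.fiber hcp
    rw [← hW] at hfib
    rw [hfib.h1Z_pos_iff] at hpos
    rw [hJ.h1Z_pos_iff]
    intro htop
    have hle : compImage (fiberChart J i p) (a + t • Pi.single i 1) ≤
        compImage (fiberChart J i p) a := by
      clear htop
      induction t with
      | zero => simp
      | succ t ih =>
        rw [succ_nsmul, ← add_assoc]
        exact (compImage_fiberChart_add_le J i p _).trans ih
    refine hpos (eq_top_iff.mpr (le_trans (ge_of_eq ?_) hle))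
    exact compImage_eq_top_of_le le_sup_left htop

end MultiProjPaper
end

section
/- Fix an integer n ≥ 2. Then there exists an integer t(n) such that for all integers t ≥ t(n) and all s ∈ ℕ, if S is a general subset of ℙ^n of cardinality s, then either h^1(ℙ^n, I_S ⊗ Ω^1_{ℙ^n}(t)) = 0 or h^0(ℙ^n, I_S ⊗ Ω^1_{ℙ^n}(t)) = 0. -/
open Module MvPolynomial
open scoped TensorProduct

namespace MultiProjPaper

/-- Type wrapper for the underlying type of a submodule. -/
def SubT {K M : Type} [Field K] [AddCommGroup M] [Module K M] (p : Submodule K M) : Type := ↥p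

noncomputable instance {K M : Type} [Field K] [AddCommGroup M] [Module K M]
    (p : Submodule K M) : AddCommGroup (SubT p) := inferInstanceAs (AddCommGroup ↥p)

noncomputable instance {K M : Type} [Field K] [AddCommGroup M] [Module K M]
    (p : Submodule K M) : Module K (SubT p) := inferInstanceAs (Module K ↥p)

/-- The underlying vector of an element of `SubT p`. -/
def SubT.val {K M : Type} [Field K] [AddCommGroup M] [Module K M] {p : Submodule K M}
    (x : SubT p) : M := x.1

/-- The Euler map `(f_0, …, f_n) ↦ ∑ x_j f_j`. -/
noncomputable def eulerMap (K : Type) [Field K] (nn : ℕ) :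
    (Fin (nn + 1) → MvPolynomial (Fin (nn + 1)) K) →ₗ[K] MvPolynomial (Fin (nn + 1)) K where
  toFun w := ∑ j, X j * w j
  map_add' a b := by simp [mul_add, Finset.sum_add_distrib]
  map_smul' c a := by simp [Finset.smul_sum, mul_smul_comm]

/-- `H^0(ℙ^n, Ω^1_{ℙ^n}(t))`, via the Euler sequence
`0 → Ω^1_{ℙ^n}(t) → O(t-1)^{n+1} → O(t) → 0`: tuples `(f_0, …, f_n)` of homogeneous
forms of degree `t-1` with `∑ x_j f_j = 0`. -/
noncomputable def omegaSec (K : Type) [Field K] (nn t : ℕ) :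
    Submodule K (Fin (nn + 1) → MvPolynomial (Fin (nn + 1)) K) :=
  (Submodule.pi Set.univ (fun _ => homogeneousSubmodule (Fin (nn + 1)) K (t - 1))) ⊓
    LinearMap.ker (eulerMap K nn)

/-- `h^0(ℙ^n, Ω^1_{ℙ^n}(t))`. -/
noncomputable def h0Omega (K : Type) [Field K] (nn t : ℕ) : ℕ :=
  finrank K (SubT (omegaSec K nn t))

/-- A (representative of a) point of `ℙ^n`: a nonzero coordinate vector. -/
structure PtPn (K : Type) [Field K] (nn : ℕ) where
  P : Fin (nn + 1) → K
  hP : P ≠ 0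

/-- "A general tuple of `s` points of `ℙ^n` satisfies `Φ`": there is a nonzero polynomial
`F` in the coordinates of the representatives of the `s` points (i.e. a nonempty Zariski
open subset of `(ℙ^n)^s`) such that every tuple of points where `F` does not vanish
satisfies `Φ`. -/
def GenericPtsPn (K : Type) [Field K] (nn s : ℕ) (Φ : (Fin s → PtPn K nn) → Prop) : Prop :=
  ∃ F : MvPolynomial (Fin s × Fin (nn + 1)) K, F ≠ 0 ∧
    ∀ T : Fin s → PtPn K nn,
      MvPolynomial.eval (fun q => (T q.1).P q.2) F ≠ 0 → Φ T

/-- Evaluation of a section of `Ω^1_{ℙ^n}(t)` at a point of `ℙ^n` (with values in the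
fiber `K^{n+1}` of the ambient `O(t-1)^{⊕(n+1)}` from the Euler sequence, in which
`Ω^1_{ℙ^n}(t)` is a subbundle). -/
noncomputable def evOmPt (K : Type) [Field K] (nn : ℕ) (pt : PtPn K nn) (t : ℕ) :
    SubT (omegaSec K nn t) →ₗ[K] (Fin (nn + 1) → K) where
  toFun w := fun j => eval pt.P (w.val j)
  map_add' a b := by
    funext j
    show eval pt.P ((a.val + b.val) j) = eval pt.P (a.val j) + eval pt.P (b.val j)
    simp
  map_smul' c a := by
    funext j
    show eval pt.P ((c • a.val) j) = c * eval pt.P (a.val j)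
    simp

/-- `H^0(ℙ^n, 𝓘_S ⊗ Ω^1_{ℙ^n}(t))`: sections of `Ω^1_{ℙ^n}(t)` vanishing at all the
points of `S`. -/
noncomputable def secOmPts (K : Type) [Field K] (nn : ℕ) {s : ℕ} (T : Fin s → PtPn K nn)
    (t : ℕ) : Submodule K (SubT (omegaSec K nn t)) :=
  ⨅ j : Fin s, LinearMap.ker (evOmPt K nn (T j) t)

/-- `h^0(ℙ^n, 𝓘_S ⊗ Ω^1_{ℙ^n}(t))`. -/
noncomputable def h0OmS (K : Type) [Field K] (nn : ℕ) {s : ℕ} (T : Fin s → PtPn K nn)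
    (t : ℕ) : ℕ :=
  finrank K (SubT (secOmPts K nn T t))

/-- `h^1(ℙ^n, 𝓘_S ⊗ Ω^1_{ℙ^n}(t))` (for `t ≥ 1`), computed from the restriction exact
sequence for the rank-`n` bundle `Ω^1_{ℙ^n}(t)` (which has `h^1 = 0` for `t ≠ 0`):
`h^1(𝓘_S ⊗ Ω^1(t)) = n·#S - (h^0(Ω^1(t)) - h^0(𝓘_S ⊗ Ω^1(t)))`. -/
noncomputable def h1OmS (K : Type) [Field K] (nn : ℕ) {s : ℕ} (T : Fin s → PtPn K nn)
    (t : ℕ) : ℤ :=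
  (nn : ℤ) * s - (h0Omega K nn t : ℤ) + (h0OmS K nn T t : ℤ)

end MultiProjPaper

namespace MultiProjPaper

theorem exists_finrank_ker_le {K V B A : Type*} [Field K] [AddCommGroup V] [Module K V]
    [FiniteDimensional K V] [Fintype B] [CommRing A] [Algebra K A] (φ : V →ₗ[K] B → A)
    (T₀ : A →ₐ[K] K) :
    ∃ F : A, T₀ F ≠ 0 ∧ ∀ T : A →ₐ[K] K, T F ≠ 0 →
      finrank K (LinearMap.ker (T.toLinearMap.compLeft B ∘ₗ φ)) ≤
        finrank K (LinearMap.ker (T₀.toLinearMap.compLeft B ∘ₗ φ)) := by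
  classical
  set L₀ := T₀.toLinearMap.compLeft B ∘ₗ φ with hL₀
  obtain ⟨V', hV'⟩ := Submodule.exists_isCompl (LinearMap.ker L₀)
  have hinj : LinearMap.ker (L₀.domRestrict V') = ⊥ := by
    rw [LinearMap.ker_eq_bot']
    intro v hv
    have h1 : (v : V) ∈ LinearMap.ker L₀ ⊓ V' := ⟨hv, v.2⟩
    rw [hV'.inf_eq_bot] at h1
    exact Subtype.ext h1
  obtain ⟨r, hr⟩ := LinearMap.exists_leftInverse_of_injective _ hinj
  let b := finBasis K V'
  let N : Matrix (Fin (finrank K V')) (Fin (finrank K V')) A :=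
    fun k l => ∑ i, algebraMap K A (b.repr (r (Pi.single i 1)) k) * φ (b l) i
  have key : ∀ T : A →ₐ[K] K, T.mapMatrix N =
      LinearMap.toMatrix b b (r ∘ₗ (T.toLinearMap.compLeft B ∘ₗ φ).domRestrict V') := by
    intro T
    ext k l
    have h2 : r (fun i => T (φ (b l) i)) = ∑ i, T (φ (b l) i) • r (Pi.single i 1) := by
      conv_lhs => rw [← Finset.univ_sum_single (fun i => T (φ (b l) i)), map_sum]
      refine Finset.sum_congr rfl fun i _ => ?_
      rw [← map_smul, ← Pi.single_smul, smul_eq_mul, mul_one]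
    simp only [AlgHom.mapMatrix_apply, Matrix.map_apply, LinearMap.toMatrix_apply,
      LinearMap.comp_apply]
    change _ = b.repr (r (fun i => T (φ (b l) i))) k
    rw [h2]
    simp [N, mul_comm]
  refine ⟨N.det, ?_, fun T hT => ?_⟩
  · rw [AlgHom.map_det, key, ← hL₀, hr]
    simp
  · rw [AlgHom.map_det, key, LinearMap.det_toMatrix] at hT
    have hk : LinearMap.ker (r ∘ₗ (T.toLinearMap.compLeft B ∘ₗ φ).domRestrict V') = ⊥ := by
      by_contra h
      exact hT (LinearMap.det_eq_zero_iff_ker_ne_bot.2 h)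
    have hd : Disjoint (LinearMap.ker (T.toLinearMap.compLeft B ∘ₗ φ)) V' := by
      rw [Submodule.disjoint_def]
      intro v hv hv'
      have h1 : (⟨v, hv'⟩ : V') ∈
          LinearMap.ker (r ∘ₗ (T.toLinearMap.compLeft B ∘ₗ φ).domRestrict V') := by
        rw [LinearMap.mem_ker, LinearMap.comp_apply, LinearMap.domRestrict_apply,
          LinearMap.mem_ker.1 hv, map_zero]
      rw [hk] at h1
      exact congrArg Subtype.val ((Submodule.mem_bot K).1 h1)
    have h1 := Submodule.finrank_add_finrank_le_of_disjoint hd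
    have h2 := Submodule.finrank_add_eq_of_isCompl hV'
    omega

theorem exists_finrank_ker_eval_le {K V B : Type*} [Field K] [Infinite K] [AddCommGroup V]
    [Module K V] [FiniteDimensional K V] [Fintype B] (φ : V →ₗ[K] B → Polynomial K)
    (L₀ L₁ : V →ₗ[K] B → K) (h₀ : ∀ v i, (φ v i).coeff 0 = L₀ v i)
    (h₁ : ∀ v i, (φ v i).coeff 1 = L₁ v i) :
    ∃ ε : K, finrank K (LinearMap.ker ((Polynomial.aeval ε).toLinearMap.compLeft B ∘ₗ φ)) ≤
      finrank K ↥(LinearMap.ker L₀ ⊓ (LinearMap.range L₀).comap L₁) := by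
  classical
  obtain ⟨r, hr⟩ := LinearMap.exists_leftInverse_of_injective (LinearMap.range L₀).subtype
    (Submodule.ker_subtype _)
  let Q : (B → K) →ₗ[K] B → K := (LinearMap.range L₀).subtype ∘ₗ r
  have hQ : ∀ v, Q (L₀ v) = L₀ v := fun v =>
    congrArg Subtype.val (LinearMap.congr_fun hr ⟨L₀ v, LinearMap.mem_range_self _ v⟩)
  have hQr : ∀ x, Q x ∈ LinearMap.range L₀ := fun x => (r x).2
  have hQsum : ∀ x i, Q x i = ∑ j, Q (Pi.single j 1) i * x j := by
    intro x i
    conv_lhs => rw [← Finset.univ_sum_single x, map_sum, Finset.sum_apply]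
    refine Finset.sum_congr rfl fun j _ => ?_
    rw [show Pi.single j (x j) = x j • (Pi.single j (1 : K) : B → K) by
      rw [← Pi.single_smul, smul_eq_mul, mul_one], map_smul, Pi.smul_apply, smul_eq_mul, mul_comm]
  let S : V → B → Polynomial K := fun v i => ∑ j, Q (Pi.single j 1) i • φ v j
  have hS : ∀ v i n, (S v i).coeff n = Q (fun j => (φ v j).coeff n) i := by
    intro v i n
    rw [hQsum]
    simp [S]
  have hQc : ∀ (c : K) (x : B → K) (i : B), Q (fun j => c * x j) i = c * Q x i :=
    fun c x i => congrFun (map_smul Q c x) i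
  let φ' : V →ₗ[K] B → Polynomial K :=
    { toFun := fun v i => S v i + (φ v i - S v i).divX
      map_add' := fun v w => by
        ext i n
        simp only [Polynomial.coeff_add, Polynomial.coeff_divX, Polynomial.coeff_sub, hS,
          Pi.add_apply, map_add]
        simp only [← Pi.add_def, map_add, Pi.add_apply]
        ring
      map_smul' := fun c v => by
        ext i n
        simp only [Polynomial.coeff_add, Polynomial.coeff_divX, Polynomial.coeff_sub, hS,
          Pi.smul_apply, map_smul, Polynomial.coeff_smul, RingHom.id_apply]
        simp only [smul_eq_mul, hQc]
        ring }
  have hφ' : ∀ v i, φ' v i = S v i + (φ v i - S v i).divX := fun _ _ => rfl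
  have e0 : ∀ v, (fun j => (φ v j).coeff 0) = L₀ v := fun v => funext fun i => h₀ v i
  have e1 : ∀ v, (fun j => (φ v j).coeff 1) = L₁ v := fun v => funext fun i => h₁ v i
  obtain ⟨F, hF0, hF⟩ := exists_finrank_ker_le φ' (Polynomial.aeval (0 : K))
  have hF0' : F * Polynomial.X ≠ 0 := by
    refine mul_ne_zero ?_ Polynomial.X_ne_zero
    rintro rfl
    simp at hF0
  obtain ⟨ε, hε⟩ : ∃ ε, (F * Polynomial.X).eval ε ≠ 0 := by
    by_contra! h
    exact hF0' (Polynomial.funext fun x => by simpa using h x)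
  rw [Polynomial.eval_mul, Polynomial.eval_X] at hε
  refine ⟨ε, le_trans ?_ ((hF (Polynomial.aeval ε) ?_).trans ?_)⟩
  · apply Submodule.finrank_mono
    intro v hv
    have hv' : ∀ i, (φ v i).eval ε = 0 := fun i => by
      have := congrFun (LinearMap.mem_ker.1 hv) i
      simpa [Polynomial.aeval_def] using this
    have hSv : ∀ i, (S v i).eval ε = 0 := fun i => by
      simp [S, Polynomial.eval_finsetSum, hv']
    rw [LinearMap.mem_ker]
    funext i
    change Polynomial.aeval ε (φ' v i) = 0
    have h3 := congrArg (Polynomial.eval ε) (Polynomial.X_mul_divX_add (φ v i - S v i))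
    rw [Polynomial.coeff_sub, hS, e0, hQ, h₀] at h3
    simp only [sub_self, map_zero, add_zero, Polynomial.eval_mul, Polynomial.eval_X,
      Polynomial.eval_sub, hv', hSv] at h3
    rw [hφ', map_add, Polynomial.coe_aeval_eq_eval, hSv, zero_add]
    exact (mul_eq_zero.1 h3).resolve_left (right_ne_zero_of_mul hε)
  · rw [Polynomial.coe_aeval_eq_eval]
    exact left_ne_zero_of_mul hε
  · apply Submodule.finrank_mono
    intro v hv
    have hv' : L₀ v + (L₁ v - Q (L₁ v)) = 0 := by
      funext i
      have h4 := congrFun (LinearMap.mem_ker.1 hv) i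
      change Polynomial.aeval (0 : K) (φ' v i) = 0 at h4
      rw [Polynomial.coe_aeval_eq_eval, ← Polynomial.coeff_zero_eq_eval_zero, hφ',
        Polynomial.coeff_add, Polynomial.coeff_divX, Polynomial.coeff_sub, hS, hS, e0, hQ] at h4
      rw [zero_add, e1, h₁] at h4
      exact h4
    have h5 : L₀ v = 0 := by
      have h6 := congrArg Q hv'
      rw [map_add, map_sub, hQ, map_zero] at h6
      obtain ⟨w, hw⟩ := hQr (L₁ v)
      rw [← hw, hQ] at h6
      rw [← hw] at hv'
      simpa [hw] using h6
    refine ⟨h5, ?_⟩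
    rw [h5, zero_add, sub_eq_zero] at hv'
    change L₁ v ∈ LinearMap.range L₀
    rw [hv']
    exact hQr _

theorem exists_submodule_finrank_le {K M B A : Type*} [Field K] [AddCommGroup M] [Module K M]
    [Fintype B] [CommRing A] [Algebra K A] (W : Submodule K M) [FiniteDimensional K W]
    (φ : M →ₗ[K] B → A) (T₀ : A →ₐ[K] K) (D : Submodule K M)
    (hD : ∀ v ∈ W, (∀ i, T₀ (φ v i) = 0) → v ∈ D) :
    ∃ F : A, T₀ F ≠ 0 ∧ ∀ T : A →ₐ[K] K, T F ≠ 0 →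
      ∀ E : Submodule K M, (∀ v ∈ E, v ∈ W ∧ ∀ i, T (φ v i) = 0) →
        finrank K E ≤ finrank K ↥(W ⊓ D) := by
  obtain ⟨F, hF0, hF⟩ := exists_finrank_ker_le (φ ∘ₗ W.subtype) T₀
  refine ⟨F, hF0, fun T hT E hE => le_trans ?_ ((hF T hT).trans ?_)⟩
  · refine LinearMap.finrank_le_finrank_of_injective
      (f := LinearMap.codRestrict _ (Submodule.inclusion fun v hv => (hE v hv).1)
        fun v => LinearMap.mem_ker.2 (funext fun i => (hE v v.2).2 i)) ?_
    intro v w h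
    exact Subtype.ext (congrArg (fun x => ((x.1 : W) : M)) h)
  · have : FiniteDimensional K ↥(W ⊓ D) := Submodule.finiteDimensional_inf_left W D
    refine LinearMap.finrank_le_finrank_of_injective
      (f := LinearMap.codRestrict (W ⊓ D) (W.subtype ∘ₗ Submodule.subtype _)
        fun v => ⟨v.1.2, hD _ v.1.2 fun i => congrFun (LinearMap.mem_ker.1 v.2) i⟩) ?_
    intro v w h
    exact Subtype.ext (Subtype.ext (congrArg (Submodule.subtype (W ⊓ D)) h))

theorem exists_submodule_finrank_eval_le {K M B : Type*} [Field K] [Infinite K] [AddCommGroup M]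
    [Module K M] [Fintype B] (W : Submodule K M) [FiniteDimensional K W]
    (φ : M →ₗ[K] B → Polynomial K) (D : Submodule K M)
    (hD : ∀ v ∈ W, (∀ i, (φ v i).coeff 0 = 0) →
      ∀ w ∈ W, (∀ i, (φ v i).coeff 1 = (φ w i).coeff 0) → v ∈ D) :
    ∃ ε : K, ∀ E : Submodule K M, (∀ v ∈ E, v ∈ W ∧ ∀ i, (φ v i).eval ε = 0) →
        finrank K E ≤ finrank K ↥(W ⊓ D) := by
  let L : ℕ → M →ₗ[K] B → K := fun n => (Polynomial.lcoeff K n).compLeft B ∘ₗ φ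
  obtain ⟨ε, hε⟩ := exists_finrank_ker_eval_le (φ ∘ₗ W.subtype) (L 0 ∘ₗ W.subtype)
    (L 1 ∘ₗ W.subtype) (fun _ _ => rfl) (fun _ _ => rfl)
  refine ⟨ε, fun E hE => le_trans ?_ (hε.trans ?_)⟩
  · refine LinearMap.finrank_le_finrank_of_injective
      (f := LinearMap.codRestrict _ (Submodule.inclusion fun v hv => (hE v hv).1)
        fun v => LinearMap.mem_ker.2 (funext fun i => ?_)) ?_
    · change Polynomial.aeval ε (φ v i) = 0
      rw [Polynomial.coe_aeval_eq_eval]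
      exact (hE v v.2).2 i
    intro v w h
    exact Subtype.ext (congrArg (fun x => ((x.1 : W) : M)) h)
  · have : FiniteDimensional K ↥(W ⊓ D) := Submodule.finiteDimensional_inf_left W D
    refine LinearMap.finrank_le_finrank_of_injective
      (f := LinearMap.codRestrict (W ⊓ D) (W.subtype ∘ₗ Submodule.subtype _)
        fun v => ⟨v.1.2, ?_⟩) ?_
    · obtain ⟨w, hw⟩ := v.2.2
      exact hD _ v.1.2 (fun i => congrFun (LinearMap.mem_ker.1 v.2.1) i) w w.2
        fun i => (congrFun hw i).symm
    intro v w h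
    exact Subtype.ext (Subtype.ext (congrArg (Submodule.subtype (W ⊓ D)) h))

/-- Choosing functionals one after the other so that each of them cuts the dimension. -/
theorem exists_choice_finrank_le {K M ι T : Type*} [Field K] [AddCommGroup M] [Module K M]
    [Fintype ι] [Nonempty T] (W : Submodule K M) [FiniteDimensional K W] (L : ι → T → M →ₗ[K] K)
    (c : ℕ) (h : ∀ i, ∀ D ≤ W, (∀ v ∈ D, ∀ τ, L i τ v = 0) → finrank K D ≤ c) :
    ∃ τ : ι → T, ∀ E : Submodule K M, (∀ v ∈ E, v ∈ W ∧ ∀ i, L i (τ i) v = 0) →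
      finrank K E ≤ max (finrank K W - Fintype.card ι) c := by
  classical
  have key : ∀ s : Finset ι, ∃ (τ : ι → T) (D : Submodule K M),
      (∀ v, v ∈ D ↔ v ∈ W ∧ ∀ i ∈ s, L i (τ i) v = 0) ∧
        finrank K D ≤ max (finrank K W - s.card) c := by
    intro s
    induction s using Finset.induction_on with
    | empty => exact ⟨fun _ => Classical.arbitrary T, W, by simp, by simp⟩
    | insert a s ha ih =>
      obtain ⟨τ, D, hD, hle⟩ := ih
      have hDW : D ≤ W := fun v hv => ((hD v).1 hv).1
      have : FiniteDimensional K D := Submodule.finiteDimensional_of_le hDW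
      obtain ⟨t, ht⟩ : ∃ t : T, c < finrank K D → ∃ v ∈ D, L a t v ≠ 0 := by
        by_contra! hcon
        obtain ⟨h1, -⟩ := hcon (Classical.arbitrary T)
        exact absurd (h a D hDW fun v hv t => (hcon t).2 v hv) (not_le.2 h1)
      refine ⟨Function.update τ a t, D ⊓ LinearMap.ker (L a t), ?_, ?_⟩
      · intro v
        rw [Submodule.mem_inf, hD, Finset.forall_mem_insert, Function.update_self,
          LinearMap.mem_ker]
        have : (∀ i ∈ s, L i (Function.update τ a t i) v = 0) ↔ ∀ i ∈ s, L i (τ i) v = 0 :=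
          forall₂_congr fun i hi => by
            rw [Function.update_of_ne (ne_of_mem_of_not_mem hi ha)]
        rw [this]
        exact and_right_comm.trans and_assoc
      · rw [Finset.card_insert_of_notMem ha]
        have hmono := Submodule.finrank_mono (inf_le_left : D ⊓ LinearMap.ker (L a t) ≤ D)
        by_cases hc : c < finrank K D
        · obtain ⟨v, hv, hv0⟩ := ht hc
          have := Submodule.finrank_lt_finrank_of_lt (s := D ⊓ LinearMap.ker (L a t)) (t := D)
            (lt_of_le_of_ne inf_le_left fun h => hv0 (LinearMap.mem_ker.1 (h.symm ▸ hv :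
              v ∈ D ⊓ LinearMap.ker (L a t)).2))
          omega
        · omega
  obtain ⟨τ, D, hD, hle⟩ := key Finset.univ
  refine ⟨τ, fun E hE => le_trans ?_ hle⟩
  have : FiniteDimensional K D :=
    Submodule.finiteDimensional_of_le (S₂ := W) fun v hv => ((hD v).1 hv).1
  exact Submodule.finrank_mono fun v hv => (hD v).2 ⟨(hE v hv).1, fun i _ => (hE v hv).2 i⟩

/-- The filter of Zariski-generic tuples of vectors of `K ^ m`. -/
def genericPts (K ι : Type) [Field K] (m : ℕ) : Filter (ι → Fin m → K) where
  sets := {U | ∃ F : MvPolynomial (ι × Fin m) K, F ≠ 0 ∧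
    ∀ x : ι → Fin m → K, eval (fun q => x q.1 q.2) F ≠ 0 → x ∈ U}
  univ_sets := ⟨1, one_ne_zero, fun _ _ => trivial⟩
  sets_of_superset := fun ⟨F, hF, h⟩ hU => ⟨F, hF, fun x hx => hU (h x hx)⟩
  inter_sets := fun ⟨F, hF, h⟩ ⟨G, hG, h'⟩ => ⟨F * G, mul_ne_zero hF hG, fun x hx => by
    rw [map_mul] at hx
    exact ⟨h x (left_ne_zero_of_mul hx), h' x (right_ne_zero_of_mul hx)⟩⟩

theorem aeval_eq_eval_apply {K σ : Type*} [CommRing K] (x : σ → K) (p : MvPolynomial σ K) :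
    aeval x p = eval x p := rfl

section
variable {K ι κ : Type} [Field K] {m : ℕ}

theorem eventually_genericPts_iff {P : (ι → Fin m → K) → Prop} :
    (∀ᶠ x in genericPts K ι m, P x) ↔ ∃ F : MvPolynomial (ι × Fin m) K, F ≠ 0 ∧
      ∀ x : ι → Fin m → K, eval (fun q => x q.1 q.2) F ≠ 0 → P x := Iff.rfl

instance [Infinite K] : (genericPts K ι m).NeBot := by
  refine ⟨fun h => ?_⟩
  obtain ⟨F, hF, h⟩ := eventually_genericPts_iff.1 (h ▸ Filter.eventually_bot (p := fun _ => False))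
  refine hF (MvPolynomial.funext fun x => ?_)
  by_contra hx
  exact h (fun i j => x (i, j)) (by simpa using hx)

theorem eventually_eval_ne_zero {F : MvPolynomial (ι × Fin m) K} (hF : F ≠ 0) :
    ∀ᶠ x in genericPts K ι m, eval (fun q => x q.1 q.2) F ≠ 0 :=
  ⟨F, hF, fun _ h => h⟩

theorem eventually_coord_ne_zero [Finite ι] (k : Fin m) :
    ∀ᶠ x in genericPts K ι m, ∀ i, x i k ≠ 0 := by
  rw [Filter.eventually_all]
  intro i
  refine (eventually_eval_ne_zero (X_ne_zero (i, k))).mono fun x hx => ?_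
  simpa using hx

theorem eventually_minor_ne_zero [Finite ι] {k l : Fin m} (hkl : k ≠ l) :
    ∀ᶠ x in genericPts K ι m, ∀ i j, i ≠ j → x i k * x j l - x i l * x j k ≠ 0 := by
  classical
  rw [Filter.eventually_all]
  intro i
  rw [Filter.eventually_all]
  intro j
  by_cases hij : i = j
  · exact Filter.Eventually.of_forall fun x h => absurd hij h
  have hF : (X (i, k) * X (j, l) - X (i, l) * X (j, k) : MvPolynomial (ι × Fin m) K) ≠ 0 := by
    intro h
    have := congrArg (eval fun q => if q = (i, k) ∨ q = (j, l) then (1 : K) else 0) h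
    simp [hkl, hij, hkl.symm] at this
  refine (eventually_eval_ne_zero hF).mono fun x hx _ => ?_
  simpa using hx

theorem tendsto_genericPts_comp {e : κ → ι} (he : Function.Injective e) :
    Filter.Tendsto (fun x : ι → Fin m → K => x ∘ e) (genericPts K ι m) (genericPts K κ m) := by
  rintro U ⟨F, hF, h⟩
  refine ⟨rename (Prod.map e id) F, ?_, fun x hx => h _ ?_⟩
  · exact fun h0 => hF (rename_injective _ (he.prodMap Function.injective_id) (by simpa using h0))
  · rw [eval_rename] at hx
    exact hx

theorem eventually_genericPts_sum {P : (ι ⊕ κ → Fin m → K) → Prop}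
    (h : ∀ᶠ x in genericPts K (ι ⊕ κ) m, P x) :
    ∀ᶠ x in genericPts K ι m, ∀ᶠ y in genericPts K κ m, P (Sum.elim x y) := by
  obtain ⟨F, hF, h⟩ := h
  let e : (ι ⊕ κ) × Fin m → κ × Fin m ⊕ ι × Fin m :=
    fun q => Sum.elim (fun i => Sum.inr (i, q.2)) (fun i => Sum.inl (i, q.2)) q.1
  have he : Function.Injective e := by
    rintro ⟨i | i, j⟩ ⟨i' | i', j'⟩ h <;> simp_all [e]
  let G := sumAlgEquiv K (κ × Fin m) (ι × Fin m) (rename e F)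
  have hG : G ≠ 0 := by
    intro h0
    rw [EmbeddingLike.map_eq_zero_iff] at h0
    exact hF (rename_injective _ he (by simpa using h0))
  obtain ⟨d, hd⟩ := ne_zero_iff.1 hG
  refine (eventually_eval_ne_zero hd).mono fun x hx => ?_
  refine ⟨map (eval fun q => x q.1 q.2) G, ?_, fun y hy => h _ ?_⟩
  · intro h0
    rw [← coeff_map, h0, coeff_zero] at hx
    exact hx rfl
  · have key : ∀ H : MvPolynomial (κ × Fin m ⊕ ι × Fin m) K,
        eval (fun q => y q.1 q.2) (map (eval fun q => x q.1 q.2)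
          (sumAlgEquiv K (κ × Fin m) (ι × Fin m) H)) =
        eval (Sum.elim (fun q => y q.1 q.2) (fun q => x q.1 q.2)) H := by
      intro H
      induction H using MvPolynomial.induction_on with
      | C a => rw [sumAlgEquiv_C_inl, map_C, eval_C, eval_C, eval_C]
      | add p q hp hq => rw [map_add, map_add, map_add, map_add, hp, hq]
      | mul_X p i hp =>
        rw [map_mul, map_mul, map_mul, map_mul, hp]
        cases i
        · rw [sumAlgEquiv_X_inl, map_X, eval_X, eval_X, Sum.elim_inl]
        · rw [sumAlgEquiv_X_inr, map_C, eval_C, eval_X, eval_X, Sum.elim_inr]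
    rw [key, eval_rename] at hy
    have hxy : (fun q : (ι ⊕ κ) × Fin m => Sum.elim x y q.1 q.2) =
        Sum.elim (fun q => y q.1 q.2) (fun q => x q.1 q.2) ∘ e := by
      funext q
      rcases q with ⟨i | i, j⟩ <;> rfl
    rw [hxy]
    exact hy

variable {M β : Type} [AddCommGroup M] [Module K M]

/-- The vectors whose images under all the maps `P b` vanish at all the points `p i`. -/
def vanishing (P : β → M →ₗ[K] MvPolynomial (Fin m) K) (p : ι → Fin m → K) : Submodule K M where
  carrier := {v | ∀ i b, eval (p i) (P b v) = 0}
  zero_mem' := by simp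
  add_mem' := by
    intro v w hv hw i b
    rw [map_add, map_add, hv, hw, add_zero]
  smul_mem' := by
    intro c v hv i b
    rw [map_smul, smul_eval, hv, mul_zero]

theorem mem_vanishing {P : β → M →ₗ[K] MvPolynomial (Fin m) K} {p : ι → Fin m → K} {v : M} :
    v ∈ vanishing P p ↔ ∀ i b, eval (p i) (P b v) = 0 := Iff.rfl

theorem eventually_finrank_vanishing_le [Finite ι] [Finite β] (W : Submodule K M)
    [FiniteDimensional K W] (P : β → M →ₗ[K] MvPolynomial (Fin m) K) (p₀ : ι → Fin m → K) :
    ∀ᶠ p in genericPts K ι m,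
      finrank K ↥(W ⊓ vanishing P p) ≤ finrank K ↥(W ⊓ vanishing P p₀) := by
  have := Fintype.ofFinite ι
  have := Fintype.ofFinite β
  let φ : M →ₗ[K] (ι × β) → MvPolynomial (ι × Fin m) K :=
    LinearMap.pi fun q => (rename (fun k => (q.1, k))).toLinearMap ∘ₗ P q.2
  have hφ : ∀ (p : ι → Fin m → K) v q,
      aeval (fun q : ι × Fin m => p q.1 q.2) (φ v q) = eval (p q.1) (P q.2 v) := by
    intro p v q
    simp only [φ, LinearMap.pi_apply, LinearMap.comp_apply, AlgHom.toLinearMap_apply, aeval_rename]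
    rw [aeval_eq_eval_apply]
    rfl
  obtain ⟨F, hF0, hF⟩ := exists_submodule_finrank_le W φ (aeval fun q => p₀ q.1 q.2)
    (vanishing P p₀) (fun v _ hv i b => by rw [← hφ p₀ v (i, b)]; exact hv (i, b))
  refine ⟨F, fun h => hF0 (by simp [h]), fun p hp => hF (aeval fun q => p q.1 q.2) ?_ _ ?_⟩
  · rwa [aeval_eq_eval_apply]
  · exact fun v hv => ⟨hv.1, fun q => by rw [hφ]; exact hv.2 q.1 q.2⟩

theorem eventually_finrank_vanishing_le_max [Infinite K] [Fintype ι] (W : Submodule K M)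
    [FiniteDimensional K W] (P : M →ₗ[K] MvPolynomial (Fin m) K) :
    ∀ᶠ p in genericPts K ι m, finrank K ↥(W ⊓ vanishing (fun _ : Unit => P) p) ≤
      max (finrank K W - Fintype.card ι) (finrank K ↥(W ⊓ LinearMap.ker P)) := by
  have : FiniteDimensional K ↥(W ⊓ LinearMap.ker P) := Submodule.finiteDimensional_inf_left _ _
  obtain ⟨p, hp⟩ := exists_choice_finrank_le (ι := ι) W
    (fun _ (q : Fin m → K) => (aeval q).toLinearMap ∘ₗ P) _ fun _ D hD h =>
      Submodule.finrank_mono (t := W ⊓ LinearMap.ker P) fun v hv => ⟨hD hv, LinearMap.mem_ker.2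
        (MvPolynomial.funext fun q => by rw [map_zero]; exact h v hv q)⟩
  exact (eventually_finrank_vanishing_le W (fun _ : Unit => P) p).mono fun q hq =>
    hq.trans (hp _ fun v hv => ⟨hv.1, fun i => hv.2 i ()⟩)

theorem eventually_finrank_vanishing_le_sub [Infinite K] [Fintype ι] (W : Submodule K M)
    [FiniteDimensional K W] (P : M →ₗ[K] MvPolynomial (Fin m) K)
    (hP : ∀ v ∈ W, P v = 0 → v = 0) :
    ∀ᶠ p in genericPts K ι m,
      finrank K ↥(W ⊓ vanishing (fun _ : Unit => P) p) ≤ finrank K W - Fintype.card ι := by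
  have h : W ⊓ LinearMap.ker P = ⊥ := (Submodule.eq_bot_iff _).2 fun v hv => hP v hv.1 hv.2
  have := eventually_finrank_vanishing_le_max (ι := ι) W P
  rwa [h, finrank_bot, max_eq_left (Nat.zero_le _)] at this
end

section
variable {K : Type} [Field K] {m d : ℕ}

/-- Forms of degree `d` in `m` variables. -/
noncomputable abbrev forms (K : Type) [Field K] (m d : ℕ) : Submodule K (MvPolynomial (Fin m) K) :=
  homogeneousSubmodule (Fin m) K d

instance : FiniteDimensional K (forms K m d) :=
  Module.Finite.of_fg (homogeneousSubmodule_fg _ _ d)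

theorem finrank_pi_const {M : Type} [AddCommGroup M] [Module K M] (W : Submodule K M)
    [FiniteDimensional K W] (r : ℕ) :
    finrank K ↥(Submodule.pi Set.univ fun _ : Fin r => W) = r * finrank K W := by
  let e : ↥(Submodule.pi Set.univ fun _ : Fin r => W) ≃ₗ[K] (Fin r → W) :=
    { toFun := fun f i => ⟨f.1 i, f.2 i trivial⟩
      invFun := fun f => ⟨fun i => f i, fun i _ => (f i).2⟩
      map_add' := fun _ _ => rfl
      map_smul' := fun _ _ => rfl
      left_inv := fun _ => rfl
      right_inv := fun _ => rfl }
  rw [e.finrank_eq, finrank_pi_fintype]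
  simp

instance {M : Type} [AddCommGroup M] [Module K M] (W : Submodule K M)
    [FiniteDimensional K W] (r : ℕ) :
    FiniteDimensional K ↥(Submodule.pi Set.univ fun _ : Fin r => W) := by
  let e : ↥(Submodule.pi Set.univ fun _ : Fin r => W) →ₗ[K] (Fin r → W) :=
    { toFun := fun f i => ⟨f.1 i, f.2 i trivial⟩
      map_add' := fun _ _ => rfl
      map_smul' := fun _ _ => rfl }
  refine FiniteDimensional.of_injective e fun f g h => ?_
  ext i : 2
  exact congrArg Subtype.val (congrFun h i)

/-- Restriction to the hyperplane `x₀ = 0`. -/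
noncomputable def res (K : Type) [Field K] (m : ℕ) :
    MvPolynomial (Fin (m + 1)) K →ₐ[K] MvPolynomial (Fin m) K :=
  aeval (Fin.cons 0 X)

/-- Extension of a polynomial by a constant along the first coordinate. -/
noncomputable def emb (K : Type) [Field K] (m : ℕ) :
    MvPolynomial (Fin m) K →ₐ[K] MvPolynomial (Fin (m + 1)) K :=
  rename Fin.succ

@[simp] theorem res_X_zero : res K m (X 0) = 0 := by simp [res]
@[simp] theorem res_X_succ (i : Fin m) : res K m (X i.succ) = X i := by simp [res]
@[simp] theorem emb_X (i : Fin m) : emb K m (X i) = X i.succ := by simp [emb]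
@[simp] theorem res_emb (f : MvPolynomial (Fin m) K) : res K m (emb K m f) = f := by
  rw [emb, res, aeval_rename]
  exact aeval_X_left_apply f

@[simp] theorem eval_emb (p : Fin (m + 1) → K) (f : MvPolynomial (Fin m) K) :
    eval p (emb K m f) = eval (fun i => p i.succ) f := eval_rename _ _ _

@[simp] theorem eval_res (q : Fin m → K) (f : MvPolynomial (Fin (m + 1)) K) :
    eval q (res K m f) = eval (Fin.cons 0 q : Fin (m + 1) → K) f := by
  induction f using MvPolynomial.induction_on with
  | C a => simp [res]
  | add f g hf hg => simp [hf, hg]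
  | mul_X f i hf =>
    rw [map_mul, map_mul, map_mul, hf]
    refine congrArg _ ?_
    cases i using Fin.cases <;> simp

theorem res_mem {f : MvPolynomial (Fin (m + 1)) K} (hf : f ∈ forms K (m + 1) d) :
    res K m f ∈ forms K m d := by
  have := ((mem_homogeneousSubmodule d f).1 hf).aeval
    (g := (Fin.cons 0 X : Fin (m + 1) → MvPolynomial (Fin m) K)) (n := 1) (fun i => by
      cases i using Fin.cases
      · exact isHomogeneous_zero _ _ _
      · exact isHomogeneous_X _ _)
  rwa [one_mul] at this

theorem emb_mem {f : MvPolynomial (Fin m) K} (hf : f ∈ forms K m d) :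
    emb K m f ∈ forms K (m + 1) d :=
  IsHomogeneous.rename_isHomogeneous hf

theorem exists_eq_emb_res_add (f : MvPolynomial (Fin (m + 1)) K) :
    ∃ q, f = emb K m (res K m f) + X 0 * q := by
  induction f using MvPolynomial.induction_on with
  | C a => exact ⟨0, by simp [res, emb]⟩
  | add f g hf hg =>
    obtain ⟨q, hq⟩ := hf
    obtain ⟨r, hr⟩ := hg
    refine ⟨q + r, ?_⟩
    rw [map_add, map_add, mul_add]
    linear_combination hq + hr
  | mul_X f i hf =>
    obtain ⟨q, hq⟩ := hf
    cases i using Fin.cases with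
    | zero => exact ⟨f, by simp [mul_comm]⟩
    | succ i =>
      refine ⟨q * X i.succ, ?_⟩
      rw [map_mul, map_mul, res_X_succ, emb_X]
      linear_combination X i.succ * hq

theorem mem_forms_of_X_mul {n : ℕ} {i : Fin m} {q : MvPolynomial (Fin m) K}
    (h : X i * q ∈ forms K m (n + 1)) : q ∈ forms K m n := by
  intro e he
  have := h (d := Finsupp.single i 1 + e) (by rwa [coeff_X_mul])
  rw [map_add, Finsupp.weight_single] at this
  simp at this
  omega

theorem exists_form_eq_emb_res_add {f : MvPolynomial (Fin (m + 1)) K}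
    (hf : f ∈ forms K (m + 1) (d + 1)) :
    ∃ q ∈ forms K (m + 1) d, f = emb K m (res K m f) + X 0 * q := by
  obtain ⟨q, hq⟩ := exists_eq_emb_res_add f
  refine ⟨q, mem_forms_of_X_mul (i := 0) ?_, hq⟩
  rw [← sub_eq_iff_eq_add'.2 hq]
  exact Submodule.sub_mem _ hf (emb_mem (res_mem hf))

theorem X_mul_mem {i : Fin m} {q : MvPolynomial (Fin m) K} (hq : q ∈ forms K m d) :
    X i * q ∈ forms K m (d + 1) := by
  rw [add_comm]
  exact (isHomogeneous_X K i).mul hq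

theorem finrank_forms_succ_succ (m d : ℕ) :
    finrank K (forms K (m + 1) (d + 1)) =
      finrank K (forms K m (d + 1)) + finrank K (forms K (m + 1) d) := by
  let f : (forms K m (d + 1) × forms K (m + 1) d) →ₗ[K] forms K (m + 1) (d + 1) :=
    LinearMap.codRestrict _ (LinearMap.coprod ((emb K m).toLinearMap ∘ₗ Submodule.subtype _)
      (LinearMap.mulLeft K (X 0) ∘ₗ Submodule.subtype _)) fun x =>
        Submodule.add_mem _ (emb_mem x.1.2) (X_mul_mem x.2.2)
  have hf : ∀ x, (f x : MvPolynomial (Fin (m + 1)) K) =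
      emb K m x.1 + X 0 * (x.2 : MvPolynomial (Fin (m + 1)) K) :=
    fun _ => rfl
  rw [← finrank_prod, LinearEquiv.finrank_eq (LinearEquiv.ofBijective f ⟨?_, ?_⟩)]
  · rw [← LinearMap.ker_eq_bot, LinearMap.ker_eq_bot']
    intro x hx
    have h1 := (hf x).symm.trans (congrArg Subtype.val hx)
    have h2 := congrArg (res K m) h1
    simp only [map_add, res_emb, map_mul, res_X_zero, zero_mul, add_zero, ZeroMemClass.coe_zero,
      map_zero] at h2
    rw [h2, map_zero, zero_add] at h1
    have h3 := (mul_eq_zero.1 h1).resolve_left (X_ne_zero 0)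
    exact Prod.ext (Subtype.ext h2) (Subtype.ext h3)
  · intro y
    obtain ⟨q, hq, h⟩ := exists_form_eq_emb_res_add y.2
    exact ⟨(⟨_, res_mem y.2⟩, ⟨q, hq⟩), Subtype.ext h.symm⟩

theorem finrank_forms_zero_right (m : ℕ) : finrank K (forms K m 0) = 1 := by
  rw [forms, homogeneousSubmodule_zero, Submodule.one_eq_span, finrank_span_singleton one_ne_zero]

theorem finrank_forms_zero_left (d : ℕ) : finrank K (forms K 0 (d + 1)) = 0 := by
  have : forms K 0 (d + 1) = ⊥ := by
    rw [eq_bot_iff]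
    intro f hf
    rw [Submodule.mem_bot]
    ext e
    by_contra he
    have := hf he
    rw [Subsingleton.elim e 0] at this
    simp at this
  rw [this, finrank_bot]

theorem finrank_forms (m d : ℕ) : finrank K (forms K m d) = Nat.multichoose m d := by
  induction m generalizing d with
  | zero =>
    cases d with
    | zero => rw [finrank_forms_zero_right, Nat.multichoose_zero_right]
    | succ d => rw [finrank_forms_zero_left, Nat.multichoose_zero_succ]
  | succ m ih =>
    induction d with
    | zero => rw [finrank_forms_zero_right, Nat.multichoose_zero_right]
    | succ d ih' => rw [finrank_forms_succ_succ, ih, ih', Nat.multichoose_succ_succ]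
end

section
variable {K : Type} [Field K] {m d : ℕ}

/-- The map `(f_i) ↦ ∑ x_i f_i`. -/
noncomputable def eulerSum (K : Type) [Field K] (m : ℕ) :
    (Fin m → MvPolynomial (Fin m) K) →ₗ[K] MvPolynomial (Fin m) K :=
  ∑ i, LinearMap.mulLeft K (X i) ∘ₗ LinearMap.proj i

theorem eulerSum_apply (f : Fin m → MvPolynomial (Fin m) K) :
    eulerSum K m f = ∑ i, X i * f i := by
  simp [eulerSum]

/-- Tuples of forms of degree `d`. -/
noncomputable abbrev formTuples (K : Type) [Field K] (r m d : ℕ) :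
    Submodule K (Fin r → MvPolynomial (Fin m) K) :=
  Submodule.pi Set.univ fun _ => forms K m d

/-- Linear syzygies of the coordinates with coefficients of degree `d`. -/
noncomputable def Om (K : Type) [Field K] (m d : ℕ) :
    Submodule K (Fin m → MvPolynomial (Fin m) K) :=
  formTuples K m m d ⊓ LinearMap.ker (eulerSum K m)

theorem mem_formTuples {r : ℕ} {f : Fin r → MvPolynomial (Fin m) K} :
    f ∈ formTuples K r m d ↔ ∀ i, f i ∈ forms K m d := by
  simp [Submodule.mem_pi]

theorem mem_Om {f : Fin m → MvPolynomial (Fin m) K} :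
    f ∈ Om K m d ↔ (∀ i, f i ∈ forms K m d) ∧ ∑ i, X i * f i = 0 := by
  rw [Om, Submodule.mem_inf, mem_formTuples, LinearMap.mem_ker, eulerSum_apply]

instance : FiniteDimensional K (Om K m d) := Submodule.finiteDimensional_inf_left _ _

/-- The parametrization of syzygies in `m + 1` variables by syzygies in `m` variables and
tuples of polynomials. -/
noncomputable def Phi (K : Type) [Field K] (m : ℕ) :
    ((Fin m → MvPolynomial (Fin m) K) × (Fin m → MvPolynomial (Fin (m + 1)) K)) →ₗ[K]
      Fin (m + 1) → MvPolynomial (Fin (m + 1)) K where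
  toFun x := Fin.cons (-∑ i, X (Fin.succ i) * x.2 i) fun i => emb K m (x.1 i) + X 0 * x.2 i
  map_add' x y := by
    ext i : 1
    cases i using Fin.cases
    · simp [mul_add, Finset.sum_add_distrib]
      ring
    · simp
      ring
  map_smul' c x := by
    ext i : 1
    cases i using Fin.cases
    · simp [Finset.smul_sum]
    · simp

theorem Phi_zero (x) : Phi K m x 0 = -∑ i, X (Fin.succ i) * x.2 i := rfl

theorem Phi_succ (x) (i : Fin m) : Phi K m x i.succ = emb K m (x.1 i) + X 0 * x.2 i := rfl

theorem Phi_injective : Function.Injective (Phi K m) := by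
  rw [← LinearMap.ker_eq_bot, LinearMap.ker_eq_bot']
  intro x hx
  have h1 : ∀ i, x.1 i = 0 := fun i => by
    have h2 := congrArg (res K m) (congrFun hx i.succ)
    simpa [Phi_succ] using h2
  refine Prod.ext (funext h1) (funext fun i => ?_)
  have h2 := congrFun hx i.succ
  rw [Phi_succ, h1, map_zero, zero_add] at h2
  exact (mul_eq_zero.1 h2).resolve_left (X_ne_zero 0)

theorem Phi_mem {x} (h1 : x.1 ∈ Om K m (d + 1)) (h2 : x.2 ∈ formTuples K m (m + 1) d) :
    Phi K m x ∈ Om K (m + 1) (d + 1) := by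
  rw [mem_Om] at h1 ⊢
  rw [mem_formTuples] at h2
  refine ⟨fun i => ?_, ?_⟩
  · cases i using Fin.cases
    · exact Submodule.neg_mem _ (Submodule.sum_mem _ fun i _ => X_mul_mem (h2 i))
    · exact Submodule.add_mem _ (emb_mem (h1.1 _)) (X_mul_mem (h2 _))
  · rw [Fin.sum_univ_succ]
    simp only [Phi_zero, Phi_succ, mul_add, Finset.sum_add_distrib]
    have h3 := congrArg (emb K m) h1.2
    simp only [map_sum, map_mul, emb_X, map_zero] at h3
    rw [h3, mul_neg, Finset.mul_sum, zero_add, neg_add_eq_zero]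
    exact Finset.sum_congr rfl fun i _ => mul_left_comm _ _ _

theorem exists_Phi_eq {f} (hf : f ∈ Om K (m + 1) (d + 1)) :
    ∃ x, x.1 ∈ Om K m (d + 1) ∧ x.2 ∈ formTuples K m (m + 1) d ∧ Phi K m x = f := by
  rw [mem_Om] at hf
  choose g hg hfg using fun i : Fin m => exists_form_eq_emb_res_add (hf.1 i.succ)
  have h1 := congrArg (res K m) hf.2
  rw [Fin.sum_univ_succ] at h1
  simp only [map_add, map_sum, map_mul, res_X_zero, res_X_succ, zero_mul, zero_add,
    map_zero] at h1
  refine ⟨(fun i => res K m (f i.succ), g), mem_Om.2 ⟨fun i => res_mem (hf.1 _), h1⟩,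
    mem_formTuples.2 hg, ?_⟩
  ext i : 1
  cases i using Fin.cases with
  | succ i => rw [Phi_succ, ← hfg]
  | zero =>
    rw [Phi_zero]
    have h2 := hf.2
    rw [Fin.sum_univ_succ] at h2
    have h3 : ∑ i : Fin m, X i.succ * f i.succ = X 0 * ∑ i : Fin m, X i.succ * g i := by
      have h4 := congrArg (emb K m) h1
      simp only [map_sum, map_mul, emb_X, map_zero] at h4
      rw [Finset.mul_sum, ← zero_add (∑ i : Fin m, X 0 * (X i.succ * g i)), ← h4,
        ← Finset.sum_add_distrib]
      refine Finset.sum_congr rfl fun i _ => ?_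
      conv_lhs => rw [hfg i]
      ring
    rw [h3, ← mul_add] at h2
    have h5 := (mul_eq_zero.1 h2).resolve_left (X_ne_zero 0)
    exact (eq_neg_of_add_eq_zero_left h5).symm

instance {M N : Type} [AddCommGroup M] [Module K M] [AddCommGroup N] [Module K N]
    (A : Submodule K M) (B : Submodule K N) [FiniteDimensional K A] [FiniteDimensional K B] :
    FiniteDimensional K (A.prod B) :=
  Module.Finite.of_fg ((Module.Finite.iff_fg.1 inferInstance).prod
    (Module.Finite.iff_fg.1 inferInstance))

theorem finrank_submodule_prod {M N : Type} [AddCommGroup M] [Module K M] [AddCommGroup N]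
    [Module K N] (A : Submodule K M) (B : Submodule K N) [FiniteDimensional K A]
    [FiniteDimensional K B] : finrank K (A.prod B) = finrank K A + finrank K B := by
  let e : A.prod B ≃ₗ[K] A × B :=
    { toFun := fun x => (⟨x.1.1, x.2.1⟩, ⟨x.1.2, x.2.2⟩)
      invFun := fun x => ⟨(x.1, x.2), x.1.2, x.2.2⟩
      map_add' := fun _ _ => rfl
      map_smul' := fun _ _ => rfl
      left_inv := fun _ => rfl
      right_inv := fun _ => rfl }
  rw [← finrank_prod, e.finrank_eq]

theorem finrank_le_add_of_prod {M N : Type} [AddCommGroup M] [Module K M] [AddCommGroup N]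
    [Module K N] (S : Submodule K (M × N)) [FiniteDimensional K S] (A : Submodule K M)
    (B : Submodule K N) [FiniteDimensional K A] [FiniteDimensional K B]
    (hA : ∀ x ∈ S, x.1 ∈ A) (hB : ∀ x ∈ S, x.1 = 0 → x.2 ∈ B) :
    finrank K S ≤ finrank K A + finrank K B := by
  let f : S →ₗ[K] M := LinearMap.fst K M N ∘ₗ S.subtype
  rw [← LinearMap.finrank_range_add_finrank_ker f]
  refine add_le_add (Submodule.finrank_mono ?_) ?_
  · rintro _ ⟨x, rfl⟩
    exact hA x x.2
  · refine LinearMap.finrank_le_finrank_of_injective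
      (f := LinearMap.codRestrict B (LinearMap.snd K M N ∘ₗ S.subtype ∘ₗ Submodule.subtype _)
        fun x => hB x x.1.2 x.2) fun x y h => ?_
    have h2 : (x : M × N).2 = (y : M × N).2 := congrArg Subtype.val h
    have h1 : (x : M × N).1 = (y : M × N).1 := Eq.trans x.2 (Eq.symm y.2)
    exact Subtype.ext (Subtype.ext (Prod.ext h1 h2))

theorem finrank_le_of_Phi {E : Submodule K (Fin (m + 1) → MvPolynomial (Fin (m + 1)) K)}
    (hE : E ≤ Om K (m + 1) (d + 1)) (E' : Submodule K
      ((Fin m → MvPolynomial (Fin m) K) × (Fin m → MvPolynomial (Fin (m + 1)) K)))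
    [FiniteDimensional K E']
    (h : ∀ x, x.1 ∈ Om K m (d + 1) → x.2 ∈ formTuples K m (m + 1) d → Phi K m x ∈ E → x ∈ E') :
    finrank K E ≤ finrank K E' := by
  refine le_trans (Submodule.finrank_mono (t := E'.map (Phi K m)) fun f hf => ?_)
    (Submodule.finrank_map_le _ _)
  obtain ⟨x, h1, h2, rfl⟩ := exists_Phi_eq (hE hf)
  exact ⟨x, h x h1 h2 hf, rfl⟩

theorem finrank_Om_succ_succ (m d : ℕ) : finrank K (Om K (m + 1) (d + 1)) =
    finrank K (Om K m (d + 1)) + m * finrank K (forms K (m + 1) d) := by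
  rw [← finrank_pi_const, ← finrank_submodule_prod]
  refine le_antisymm (finrank_le_of_Phi le_rfl _ fun x h1 h2 _ => ⟨h1, h2⟩) ?_
  refine LinearMap.finrank_le_finrank_of_injective
    (f := LinearMap.codRestrict _ (Phi K m ∘ₗ Submodule.subtype _)
      fun x => Phi_mem x.2.1 x.2.2) fun x y h => ?_
  exact Subtype.ext (Phi_injective (congrArg Subtype.val h))

theorem finrank_Om_one (d : ℕ) : finrank K (Om K 1 d) = 0 := by
  have : Om K 1 d = ⊥ := by
    rw [eq_bot_iff]
    intro f hf
    have h := (mem_Om.1 hf).2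
    rw [Fin.sum_univ_one] at h
    refine (Submodule.mem_bot K).2 (funext fun i => ?_)
    rw [Subsingleton.elim i 0]
    exact (mul_eq_zero.1 h).resolve_left (X_ne_zero 0)
  rw [this, finrank_bot]

theorem finrank_Om_add_finrank_forms (m d : ℕ) :
    finrank K (Om K (m + 1) (d + 1)) + finrank K (forms K m (d + 2)) =
      m * finrank K (forms K (m + 1) (d + 1)) := by
  induction m with
  | zero => rw [finrank_Om_one, finrank_forms_zero_left, zero_mul, add_zero]
  | succ m ih =>
    rw [finrank_Om_succ_succ, finrank_forms_succ_succ (m + 1) d, finrank_forms_succ_succ m (d + 1)]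
    linarith
end

section
variable {K : Type} [Field K] {m d s u σ b : ℕ} {ι κ : Type}

/-- The coordinate projections on tuples of polynomials. -/
noncomputable abbrev coords (K : Type) [Field K] (r m : ℕ) (i : Fin r) :
    (Fin r → MvPolynomial (Fin m) K) →ₗ[K] MvPolynomial (Fin m) K := LinearMap.proj i

/-- Some `s` points impose conditions on `Om K m d` leaving a space of dimension at most `b`. -/
def Bd (K : Type) [Field K] (m d s b : ℕ) : Prop :=
  ∃ p : Fin s → Fin m → K, finrank K ↥(Om K m d ⊓ vanishing (coords K m m) p) ≤ b

theorem Bd.of_points [Fintype ι] (p : ι → Fin m → K)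
    (h : finrank K ↥(Om K m d ⊓ vanishing (coords K m m) p) ≤ b) (hs : Fintype.card ι = s) :
    Bd K m d s b := by
  refine ⟨p ∘ (Fintype.equivFinOfCardEq hs).symm, le_trans (le_of_eq ?_) h⟩
  have : vanishing (coords K m m) (p ∘ (Fintype.equivFinOfCardEq hs).symm) =
      vanishing (coords K m m) p := by
    ext f
    exact (Fintype.equivFinOfCardEq hs).symm.surjective.forall (p := fun i => ∀ j,
      eval (p i) (coords K m m j f) = 0).symm
  rw [this]

theorem Bd.eventually [Fintype ι] (h : Bd K m d s b) (hs : Fintype.card ι = s) :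
    ∀ᶠ p in genericPts K ι m, finrank K ↥(Om K m d ⊓ vanishing (coords K m m) p) ≤ b := by
  obtain ⟨p, hp⟩ := h
  refine (eventually_finrank_vanishing_le (Om K m d) (coords K m m)
    (p ∘ Fintype.equivFinOfCardEq hs)).mono fun q hq => hq.trans (le_trans (le_of_eq ?_) hp)
  have : vanishing (coords K m m) (p ∘ (Fintype.equivFinOfCardEq hs)) =
      vanishing (coords K m m) p := by
    ext f
    exact (Fintype.equivFinOfCardEq hs).surjective.forall (p := fun i => ∀ j,
      eval (p i) (coords K m m j f) = 0).symm
  rw [this]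

theorem Bd.mono_right {b' : ℕ} (h : Bd K m d s b) (hb : b ≤ b') : Bd K m d s b' :=
  h.imp fun _ hp => hp.trans hb

theorem Bd.mono_left {s' : ℕ} (h : Bd K m d s b) (hs : s ≤ s') : Bd K m d s' b := by
  obtain ⟨k, rfl⟩ := Nat.exists_eq_add_of_le hs
  obtain ⟨p, hp⟩ := h
  refine .of_points (Sum.elim p (fun _ : Fin k => 0)) (le_trans (Submodule.finrank_mono ?_) hp)
    (by simp)
  exact inf_le_inf_left _ fun f hf i => hf (Sum.inl i)

theorem Bd_self (s : ℕ) : Bd K m d s (finrank K (Om K m d)) :=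
  ⟨0, Submodule.finrank_mono inf_le_left⟩

theorem formTuples_inf_vanishing (r : ℕ) (p : ι → Fin m → K) :
    formTuples K r m d ⊓ vanishing (coords K r m) p =
      Submodule.pi Set.univ fun _ : Fin r =>
        forms K m d ⊓ vanishing (fun _ : Unit => LinearMap.id) p := by
  ext f
  simp only [Submodule.mem_inf, mem_vanishing, Submodule.mem_pi, Set.mem_univ,
    LinearMap.proj_apply, LinearMap.id_apply, forall_const]
  exact ⟨fun h i => ⟨h.1 i, fun j => h.2 j i⟩, fun h => ⟨fun i => (h i).1, fun j i => (h i).2 j⟩⟩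

instance (W : Submodule K (MvPolynomial (Fin m) K)) :
    FiniteDimensional K ↥(forms K m d ⊓ W) := Submodule.finiteDimensional_inf_left _ _

instance {r : ℕ} (W : Submodule K (Fin r → MvPolynomial (Fin m) K)) :
    FiniteDimensional K ↥(formTuples K r m d ⊓ W) := Submodule.finiteDimensional_inf_left _ _

instance (W : Submodule K (Fin m → MvPolynomial (Fin m) K)) :
    FiniteDimensional K ↥(Om K m d ⊓ W) := Submodule.finiteDimensional_inf_left _ _

instance {M : Type} [AddCommGroup M] [Module K M] (A B C : Submodule K M)
    [FiniteDimensional K ↥(A ⊓ B)] : FiniteDimensional K ↥(A ⊓ B ⊓ C) :=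
  Submodule.finiteDimensional_inf_left _ _

theorem eventually_finrank_forms_le [Infinite K] [Fintype ι] :
    ∀ᶠ p in genericPts K ι m, finrank K ↥(forms K m d ⊓
      vanishing (fun _ : Unit => LinearMap.id) p) ≤ finrank K (forms K m d) - Fintype.card ι :=
  eventually_finrank_vanishing_le_sub _ _ fun _ _ h => h

theorem eventually_finrank_formTuples_le [Infinite K] [Fintype ι] (r : ℕ) :
    ∀ᶠ p in genericPts K ι m, finrank K ↥(formTuples K r m d ⊓ vanishing (coords K r m) p) ≤
      r * (finrank K (forms K m d) - Fintype.card ι) :=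
  eventually_finrank_forms_le.mono fun p hp => by
    rw [formTuples_inf_vanishing, finrank_pi_const]
    exact Nat.mul_le_mul_left r hp

theorem exists_Bd_zero [Infinite K] : ∃ s, Bd K m d s 0 := by
  refine ⟨finrank K (forms K m d), ?_⟩
  obtain ⟨p, hp⟩ := (eventually_finrank_formTuples_le (K := K) (m := m) (d := d)
    (ι := Fin (finrank K (forms K m d))) m).exists
  refine ⟨p, le_trans (Submodule.finrank_mono (inf_le_inf_right _ inf_le_left)) (hp.trans ?_)⟩
  simp

theorem eval_zero_form {f : MvPolynomial (Fin m) K} (hf : f ∈ forms K m (d + 1)) :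
    eval 0 f = 0 := by
  rw [eval_zero, constantCoeff_eq]
  by_contra h
  have := hf h
  simp at this

/-- Removing a point raises the dimension by at most the rank. -/
theorem finrank_Om_inf_vanishing_castSucc_le (p : Fin (s + 1) → Fin (m + 1) → K) :
    finrank K ↥(Om K (m + 1) (d + 1) ⊓
        vanishing (coords K (m + 1) (m + 1)) fun i : Fin s => p i.castSucc) ≤
      finrank K ↥(Om K (m + 1) (d + 1) ⊓ vanishing (coords K (m + 1) (m + 1)) p) + m := by
  let W := Om K (m + 1) (d + 1) ⊓ vanishing (coords K (m + 1) (m + 1)) fun i : Fin s => p i.castSucc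
  change finrank K W ≤ _
  let q := p (Fin.last s)
  let f : W →ₗ[K] Fin (m + 1) → K :=
    LinearMap.pi (fun j => (aeval q).toLinearMap ∘ₗ coords K (m + 1) (m + 1) j) ∘ₗ W.subtype
  have hf : ∀ (v : W) j, f v j = eval q (v.1 j) := fun _ _ => rfl
  rw [← LinearMap.finrank_range_add_finrank_ker f, add_comm]
  refine add_le_add ?_ ?_
  · refine LinearMap.finrank_le_finrank_of_injective
      (f := LinearMap.codRestrict _ (W.subtype ∘ₗ Submodule.subtype _)
        fun v => ⟨v.1.2.1, fun i j => ?_⟩) fun v w h => ?_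
    · induction i using Fin.lastCases with
      | last => exact congrFun (LinearMap.mem_ker.1 v.2) j
      | cast i => exact v.1.2.2 i j
    · exact Subtype.ext (Subtype.ext (congrArg (Submodule.subtype
        (Om K (m + 1) (d + 1) ⊓ vanishing (coords K (m + 1) (m + 1)) p)) h))
  · by_cases hq : q = 0
    · have : LinearMap.range f = ⊥ := by
        rw [LinearMap.range_eq_bot]
        ext v j
        have h1 := (mem_Om.1 v.2.1).1 j
        rw [hf, hq]
        exact eval_zero_form h1
      rw [this, finrank_bot]
      exact Nat.zero_le _
    · let l : (Fin (m + 1) → K) →ₗ[K] K := ∑ j, q j • LinearMap.proj j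
      have hl : ∀ v, l v = ∑ j, q j * v j := fun v => by simp [l]
      have hl0 : LinearMap.ker l < ⊤ := by
        rw [lt_top_iff_ne_top]
        intro h
        refine hq (funext fun j => ?_)
        have := LinearMap.mem_ker.1 (h ▸ Submodule.mem_top : Pi.single j 1 ∈ LinearMap.ker l)
        rw [hl] at this
        simpa [Pi.single_apply] using this
      have h2 := Submodule.finrank_lt hl0.ne
      have h3 : finrank K (LinearMap.range f) ≤ finrank K (LinearMap.ker l) := by
        refine Submodule.finrank_mono ?_
        rintro _ ⟨v, rfl⟩
        have h4 := congrArg (eval q) (mem_Om.1 v.2.1).2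
        rw [LinearMap.mem_ker, hl]
        simpa [hf] using h4
      simp at h2
      omega

theorem Bd.pred (h : Bd K (m + 1) (d + 1) (s + 1) b) : Bd K (m + 1) (d + 1) s (b + m) :=
  let ⟨p, hp⟩ := h
  ⟨_, (finrank_Om_inf_vanishing_castSucc_le p).trans (Nat.add_le_add_right hp m)⟩

theorem finrank_Om_le_add_mul (p : Fin s → Fin (m + 1) → K) :
    finrank K (Om K (m + 1) (d + 1)) ≤
      finrank K ↥(Om K (m + 1) (d + 1) ⊓ vanishing (coords K (m + 1) (m + 1)) p) + m * s := by
  induction s with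
  | zero =>
    exact (Submodule.finrank_mono (le_inf le_rfl fun _ _ i => i.elim0)).trans (Nat.le_add_right _ _)
  | succ s ih =>
    have h1 := ih fun i => p i.castSucc
    have h2 := finrank_Om_inf_vanishing_castSucc_le (d := d) p
    rw [Nat.mul_succ]
    omega

/-- The restriction to `x₀ = 0` of `∑ xᵢ gᵢ`. -/
noncomputable def psi (K : Type) [Field K] (m : ℕ) :
    (Fin m → MvPolynomial (Fin (m + 1)) K) →ₗ[K] MvPolynomial (Fin m) K :=
  ∑ i, LinearMap.mulLeft K (X i) ∘ₗ (res K m).toLinearMap ∘ₗ LinearMap.proj i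

theorem psi_apply (g : Fin m → MvPolynomial (Fin (m + 1)) K) :
    psi K m g = ∑ i, X i * res K m (g i) := by
  simp [psi]

theorem eval_psi (q : Fin m → K) (g : Fin m → MvPolynomial (Fin (m + 1)) K) :
    eval q (psi K m g) = ∑ i, q i * eval (Fin.cons 0 q : Fin (m + 1) → K) (g i) := by
  simp [psi_apply]

theorem eval_Phi_zero (p : Fin (m + 1) → K) (x) :
    eval p (Phi K m x 0) = -∑ i, p (Fin.succ i) * eval p (x.2 i) := by
  simp [Phi_zero]

theorem eval_Phi_succ (p : Fin (m + 1) → K) (x) (i : Fin m) :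
    eval p (Phi K m x i.succ) = eval (fun i => p i.succ) (x.1 i) + p 0 * eval p (x.2 i) := by
  simp [Phi_succ]

theorem psi_injective_of_finrank {p : ι → Fin (m + 1) → K} (hp : ∀ i, p i 0 ≠ 0)
    (h : finrank K ↥(Om K (m + 1) d ⊓ vanishing (coords K (m + 1) (m + 1)) p) ≤ 0)
    {g} (hg : g ∈ formTuples K m (m + 1) d) (hgp : g ∈ vanishing (coords K m (m + 1)) p)
    (h0 : psi K m g = 0) : g = 0 := by
  have hS : ∑ i, X (Fin.succ i) * g i ∈ forms K (m + 1) (d + 1) :=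
    Submodule.sum_mem _ fun i _ => X_mul_mem (mem_formTuples.1 hg i)
  obtain ⟨q, hq, hS⟩ := exists_form_eq_emb_res_add hS
  have h1 : res K m (∑ i, X (Fin.succ i) * g i) = psi K m g := by
    simp [psi_apply]
  rw [h1, h0, map_zero, zero_add] at hS
  have hmem : (Fin.cons (-q) g : Fin (m + 1) → MvPolynomial (Fin (m + 1)) K) ∈
      Om K (m + 1) d ⊓ vanishing (coords K (m + 1) (m + 1)) p := by
    refine ⟨mem_Om.2 ⟨fun i => ?_, ?_⟩, fun i j => ?_⟩
    · cases i using Fin.cases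
      · exact Submodule.neg_mem _ hq
      · exact mem_formTuples.1 hg _
    · rw [Fin.sum_univ_succ]
      simp [hS]
    · cases j using Fin.cases
      · have h2 := congrArg (eval (p i)) hS
        have h3 : ∀ j, eval (p i) (g j) = 0 := hgp i
        simp only [map_sum, map_mul, h3, mul_zero, Finset.sum_const_zero, eval_X] at h2
        simpa using (mul_eq_zero.1 h2.symm).resolve_left (hp i)
      · exact hgp i _
  rw [Submodule.finrank_eq_zero.1 (Nat.le_zero.1 h), Submodule.mem_bot] at hmem
  exact funext fun i => congrFun hmem i.succ

/-- Bounding a space of syzygies in `m + 1` variables by its trace on `x₀ = 0` and the residual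
space. -/
theorem finrank_le_add_of_Phi {E : Submodule K (Fin (m + 1) → MvPolynomial (Fin (m + 1)) K)}
    (hE : E ≤ Om K (m + 1) (d + 1)) (A : Submodule K (Fin m → MvPolynomial (Fin m) K))
    (B : Submodule K (Fin m → MvPolynomial (Fin (m + 1)) K))
    [FiniteDimensional K A] [FiniteDimensional K B]
    (hA : ∀ x, x.1 ∈ Om K m (d + 1) → x.2 ∈ formTuples K m (m + 1) d → Phi K m x ∈ E → x.1 ∈ A)
    (hB : ∀ g ∈ formTuples K m (m + 1) d, Phi K m (0, g) ∈ E → g ∈ B) :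
    finrank K E ≤ finrank K A + finrank K B := by
  let E' := (Om K m (d + 1)).prod (formTuples K m (m + 1) d) ⊓ E.comap (Phi K m)
  have : FiniteDimensional K E' := Submodule.finiteDimensional_inf_left _ _
  refine (finrank_le_of_Phi hE E' fun x h1 h2 h3 => ⟨⟨h1, h2⟩, h3⟩).trans
    (finrank_le_add_of_prod E' A B (fun x hx => hA x hx.1.1 hx.1.2 hx.2) ?_)
  rintro ⟨_, g⟩ ⟨⟨_, hg⟩, hx⟩ rfl
  exact hB g hg hx

theorem vanishing_of_Phi_zero {p : ι → Fin (m + 1) → K} (hp : ∀ i, p i 0 ≠ 0)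
    {g : Fin m → MvPolynomial (Fin (m + 1)) K}
    (h : Phi K m (0, g) ∈ vanishing (coords K (m + 1) (m + 1)) p) :
    g ∈ vanishing (coords K m (m + 1)) p := fun i j => by
  have h1 : eval (p i) (Phi K m (0, g) j.succ) = 0 := h i j.succ
  rw [eval_Phi_succ] at h1
  simpa [hp] using h1

theorem horace [Infinite K] (hσ : Bd K m (d + 1) σ b) (hu : Bd K (m + 1) d u 0) :
    Bd K (m + 1) (d + 1) (σ + u) (b + (m * (finrank K (forms K (m + 1) d) - u) - σ)) := by
  obtain ⟨p, ⟨hp0, hp1⟩, hp2⟩ := (((eventually_coord_ne_zero (K := K) (ι := Fin u) 0).and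
    (hu.eventually (Fintype.card_fin u))).and (eventually_finrank_formTuples_le m (d := d))).exists
  rw [Fintype.card_fin] at hp2
  obtain ⟨q, hq1, hq2⟩ := ((hσ.eventually (Fintype.card_fin σ)).and
    (eventually_finrank_vanishing_le_sub (formTuples K m (m + 1) d ⊓
      vanishing (coords K m (m + 1)) p) (psi K m)
      fun g hg h0 => psi_injective_of_finrank hp0 hp1 hg.1 hg.2 h0)).exists
  rw [Fintype.card_fin] at hq2
  refine .of_points (Sum.elim (fun i => (Fin.cons 0 (q i) : Fin (m + 1) → K)) p) ?_ (by simp)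
  refine (finrank_le_add_of_Phi inf_le_left (Om K m (d + 1) ⊓ vanishing (coords K m m) q)
    (formTuples K m (m + 1) d ⊓ vanishing (coords K m (m + 1)) p ⊓
      vanishing (fun _ : Unit => psi K m) q) ?_ ?_).trans
    (add_le_add hq1 (hq2.trans (Nat.sub_le_sub_right hp2 σ)))
  · refine fun x h1 _ hx => ⟨h1, fun i j => ?_⟩
    have h2 := hx.2 (Sum.inl i) j.succ
    simp only [LinearMap.proj_apply] at h2
    rw [eval_Phi_succ] at h2
    simpa using h2
  · refine fun g hg hx => ⟨⟨hg, vanishing_of_Phi_zero hp0 fun i => hx.2 (Sum.inr i)⟩, fun i _ => ?_⟩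
    have h2 := hx.2 (Sum.inl i) 0
    simp only [LinearMap.proj_apply] at h2
    rw [eval_Phi_zero] at h2
    rw [eval_psi]
    simpa using h2

theorem horace_zero [Infinite K] : Bd K (m + 1) (d + 1) u
    (finrank K (Om K m (d + 1)) + m * (finrank K (forms K (m + 1) d) - u)) := by
  obtain ⟨p, hp0, hp⟩ := ((eventually_coord_ne_zero (K := K) (ι := Fin u) (m := m + 1) 0).and
    (eventually_finrank_formTuples_le m (d := d))).exists
  rw [Fintype.card_fin] at hp
  exact ⟨p, (finrank_le_add_of_Phi inf_le_left (Om K m (d + 1)) (formTuples K m (m + 1) d ⊓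
    vanishing (coords K m (m + 1)) p) (fun x h1 _ _ => h1)
    fun g hg hx => ⟨hg, vanishing_of_Phi_zero hp0 hx.2⟩).trans (Nat.add_le_add_left hp _)⟩
end

section
variable {K : Type} [Field K] {m d r j : ℕ} {ι : Type}

/-- Restriction of polynomials to the line `p + X v`. -/
noncomputable def line (p v : Fin m → K) : MvPolynomial (Fin m) K →ₐ[K] Polynomial K :=
  aeval fun i => Polynomial.C (p i) + Polynomial.X * Polynomial.C (v i)

theorem line_X (p v : Fin m → K) (i : Fin m) :
    line p v (X i) = Polynomial.C (p i) + Polynomial.X * Polynomial.C (v i) :=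
  aeval_X _ i

theorem eval_line (p v : Fin m → K) (ε : K) (f : MvPolynomial (Fin m) K) :
    (line p v f).eval ε = eval (fun i => p i + ε * v i) f := by
  have : ((Polynomial.aeval ε).comp (line p v)) = aeval fun i => p i + ε * v i := by
    ext i
    simp [line_X]
    ring
  exact DFunLike.congr_fun this f

theorem coeff_zero_line (p v : Fin m → K) (f : MvPolynomial (Fin m) K) :
    (line p v f).coeff 0 = eval p f := by
  rw [Polynomial.coeff_zero_eq_eval_zero, eval_line]
  simp

theorem line_emb (p : Fin m → K) (f : MvPolynomial (Fin m) K) :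
    line (Fin.cons 0 p : Fin (m + 1) → K) (Fin.cons 1 0) (emb K m f) =
      Polynomial.C (eval p f) := by
  have : (line (Fin.cons 0 p : Fin (m + 1) → K) (Fin.cons 1 0)).comp (emb K m) =
      (Algebra.ofId K (Polynomial K)).comp (aeval p) := by
    ext i : 1
    simp [line_X, Algebra.ofId_apply]
  exact DFunLike.congr_fun this f

/-- The derivative at `p` in the direction `v`. -/
noncomputable def dirDeriv (p v : Fin m → K) : MvPolynomial (Fin m) K →ₗ[K] K :=
  Polynomial.lcoeff K 1 ∘ₗ (line p v).toLinearMap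

theorem dirDeriv_apply (p v : Fin m → K) (f) : dirDeriv p v f = (line p v f).coeff 1 := rfl

theorem dirDeriv_mul (p v : Fin m → K) (f g) :
    dirDeriv p v (f * g) = eval p f * dirDeriv p v g + dirDeriv p v f * eval p g := by
  simp only [dirDeriv_apply, map_mul, Polynomial.mul_coeff_one, coeff_zero_line]

theorem dirDeriv_X (p v : Fin m → K) (i : Fin m) : dirDeriv p v (X i) = v i := by
  simp [dirDeriv_apply, line_X]

theorem finrank_forms_inf_ker_res : finrank K ↥(forms K (m + 1) (d + 1) ⊓
    LinearMap.ker (res K m).toLinearMap) ≤ finrank K (forms K (m + 1) d) := by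
  refine le_trans (Submodule.finrank_mono
    (t := (forms K (m + 1) d).map (LinearMap.mulLeft K (X 0))) fun f hf => ?_)
    (Submodule.finrank_map_le _ _)
  obtain ⟨q, hq, h⟩ := exists_form_eq_emb_res_add hf.1
  have h0 : res K m f = 0 := hf.2
  rw [h0, map_zero, zero_add] at h
  exact ⟨q, hq, h.symm⟩

/-- Forms in `m + 1` variables vanishing at points of the hyperplane `x₀ = 0`. -/
noncomputable def formsAt (d : ℕ) (p : ι → Fin m → K) :
    Submodule K (MvPolynomial (Fin (m + 1)) K) :=
  forms K (m + 1) d ⊓ vanishing (fun _ : Unit => (res K m).toLinearMap) p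

instance (p : ι → Fin m → K) : FiniteDimensional K (formsAt d p) :=
  Submodule.finiteDimensional_inf_left _ _

theorem mem_formsAt {p : ι → Fin m → K} {f : MvPolynomial (Fin (m + 1)) K} :
    f ∈ formsAt d p ↔ f ∈ forms K (m + 1) d ∧
      ∀ i, eval (Fin.cons 0 (p i) : Fin (m + 1) → K) f = 0 := by
  refine and_congr_right fun _ => forall_congr' fun i => ?_
  rw [forall_const, ← eval_res]
  rfl

/-- Forms in `r + 2` variables vanishing at the points `p k` of the hyperplane `x₀ = 0` and with
vanishing derivatives along `x₀ = x₁ = 0` at the `i`-th point. -/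
noncomputable def formsSing (d : ℕ) (p : ι → Fin (r + 1) → K) (i : ι) :
    Submodule K (MvPolynomial (Fin (r + 2)) K) :=
  formsAt d p ⊓ ⨅ l : Fin r, LinearMap.ker
    (dirDeriv (Fin.cons 0 (p i) : Fin (r + 2) → K) (Fin.cons 0 (Fin.cons 0 (Pi.single l 1))))

instance (p : ι → Fin (r + 1) → K) (i : ι) : FiniteDimensional K (formsSing d p i) :=
  Submodule.finiteDimensional_inf_left _ _

theorem exists_separating_form {p : Fin j → Fin (r + 2) → K} (h0 : ∀ i, p i 0 ≠ 0)
    (h01 : ∀ i k, i ≠ k → p i 0 * p k 1 - p i 1 * p k 0 ≠ 0) (hj : j ≤ d + 1) (i : Fin j) :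
    ∃ q ∈ forms K (r + 3) d, eval (Fin.cons 0 (p i) : Fin (r + 3) → K) q ≠ 0 ∧
      ∀ k, k ≠ i → eval (Fin.cons 0 (p k) : Fin (r + 3) → K) q = 0 := by
  classical
  let a (k : Fin j) : MvPolynomial (Fin (r + 3)) K := X 1 * C (p k 1) - X 2 * C (p k 0)
  have ha : ∀ k l, eval (Fin.cons 0 (p l) : Fin (r + 3) → K) (a k) =
      p l 0 * p k 1 - p l 1 * p k 0 := by
    intro k l
    have h2 : (2 : Fin (r + 3)) = Fin.succ 1 := rfl
    have h1 : (1 : Fin (r + 3)) = Fin.succ 0 := rfl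
    simp only [a, map_sub, map_mul, eval_X, eval_C, h2, h1, Fin.cons_succ]
  have hah : ∀ k, (a k).IsHomogeneous 1 := by
    intro k
    refine IsHomogeneous.sub ?_ ?_
    · simpa using (isHomogeneous_X K (1 : Fin (r + 3))).mul (isHomogeneous_C _ (p k 1))
    · simpa using (isHomogeneous_X K (2 : Fin (r + 3))).mul (isHomogeneous_C _ (p k 0))
  have h1 : (1 : Fin (r + 3)) = Fin.succ 0 := rfl
  refine ⟨(∏ k ∈ Finset.univ.erase i, a k) * X 1 ^ (d + 1 - j), ?_, ?_, fun k hk => ?_⟩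
  · have := (IsHomogeneous.prod (Finset.univ.erase i) a (fun _ => 1) fun k _ => hah k).mul
      ((isHomogeneous_X K (1 : Fin (r + 3))).pow (d + 1 - j))
    have hd : ∑ k ∈ Finset.univ.erase i, 1 + 1 * (d + 1 - j) = d := by
      have := i.pos
      simp
      omega
    rw [hd] at this
    exact this
  · rw [map_mul, map_prod, map_pow, eval_X, h1, Fin.cons_succ]
    refine mul_ne_zero (Finset.prod_ne_zero_iff.2 fun k hk => ?_) (pow_ne_zero _ (h0 i))
    rw [ha]
    exact h01 i k (Finset.ne_of_mem_erase hk).symm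
  · rw [map_mul, map_prod, Finset.prod_eq_zero (Finset.mem_erase.2 ⟨hk, Finset.mem_univ k⟩),
      zero_mul]
    rw [ha]
    ring

theorem finrank_formsSing_le {p : Fin j → Fin (r + 2) → K} (h0 : ∀ i, p i 0 ≠ 0)
    (h01 : ∀ i k, i ≠ k → p i 0 * p k 1 - p i 1 * p k 0 ≠ 0) (hj : j ≤ d + 1) (i : Fin j) :
    finrank K (formsSing (d + 1) p i) ≤ finrank K (formsAt (d + 1) p) - (r + 1) := by
  obtain ⟨q, hq, hqi, hqk⟩ := exists_separating_form h0 h01 hj i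
  let P : Fin (r + 3) → K := Fin.cons 0 (p i)
  let D : formsAt (d + 1) p →ₗ[K] Fin (r + 1) → K :=
    LinearMap.pi (fun l => dirDeriv P (Fin.cons 0 (Fin.cons 0 (Pi.single l 1)))) ∘ₗ
      Submodule.subtype _
  let a (l : Fin (r + 1)) : MvPolynomial (Fin (r + 3)) K :=
    p i 0 • X l.succ.succ - p i l.succ • X 1
  have h1 : (1 : Fin (r + 3)) = Fin.succ 0 := rfl
  have ha : ∀ l, eval P (a l) = 0 := by
    intro l
    simp only [a, map_sub, smul_eval, eval_X, h1, P, Fin.cons_succ]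
    ring
  have hf : ∀ l, a l * q ∈ formsAt (d + 1) p := by
    intro l
    refine mem_formsAt.2 ⟨?_, fun k => ?_⟩
    · simp only [a, sub_mul, smul_mul_assoc]
      exact Submodule.sub_mem _ (Submodule.smul_mem _ _ (X_mul_mem hq))
        (Submodule.smul_mem _ _ (X_mul_mem hq))
    · rw [map_mul]
      by_cases hk : k = i
      · rw [hk]
        exact mul_eq_zero_of_left (ha l) _
      · rw [hqk k hk, mul_zero]
  have hD : ∀ l, D ⟨a l * q, hf l⟩ = (p i 0 * eval P q) • Pi.single l 1 := by
    intro l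
    ext l'
    have : D ⟨a l * q, hf l⟩ l' =
      dirDeriv P (Fin.cons 0 (Fin.cons 0 (Pi.single l' 1))) (a l * q) := rfl
    rw [this, dirDeriv_mul, ha, zero_mul, zero_add]
    simp only [a, map_sub, map_smul, dirDeriv_X, h1, Fin.cons_succ, Fin.cons_zero]
    by_cases hl : l = l'
    · subst hl
      simp
    · simp [hl, Ne.symm hl]
  have hc : p i 0 * eval P q ≠ 0 := mul_ne_zero (h0 i) hqi
  have hsurj : LinearMap.range D = ⊤ := by
    rw [eq_top_iff, ← (Pi.basisFun K (Fin (r + 1))).span_eq, Submodule.span_le]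
    rintro _ ⟨l, rfl⟩
    refine ⟨(p i 0 * eval P q)⁻¹ • ⟨a l * q, hf l⟩, ?_⟩
    rw [map_smul, hD, smul_smul, inv_mul_cancel₀ hc, one_smul, Pi.basisFun_apply]
  have h2 := LinearMap.finrank_range_add_finrank_ker D
  rw [hsurj, finrank_top, Module.finrank_fin_fun] at h2
  have h3 : finrank K (formsSing (d + 1) p i) ≤ finrank K (LinearMap.ker D) := by
    refine LinearMap.finrank_le_finrank_of_injective
      (f := LinearMap.codRestrict _ (Submodule.inclusion inf_le_left) fun v => ?_) fun v w h => ?_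
    · refine LinearMap.mem_ker.2 (funext fun l => ?_)
      exact LinearMap.mem_ker.1 ((Submodule.mem_iInf _).1 v.2.2 l)
    · exact Subtype.ext (congrArg (fun z => z.1.1) h)
  omega
end

section
variable {K : Type} [Field K] {m d r j b s : ℕ} {ι κ : Type}

/-- Evaluation of a tuple of polynomials. -/
noncomputable def evalTuple (r : ℕ) (q : Fin m → K) :
    (Fin r → MvPolynomial (Fin m) K) →ₗ[K] Fin r → K :=
  LinearMap.pi fun k => (aeval q).toLinearMap ∘ₗ LinearMap.proj k

/-- The restrictions to `x₀ = 0` of the coordinates of a tuple of polynomials. -/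
noncomputable abbrev resCoords (K : Type) [Field K] (s m : ℕ) (i : Fin s) :
    (Fin s → MvPolynomial (Fin (m + 1)) K) →ₗ[K] MvPolynomial (Fin m) K :=
  (res K m).toLinearMap ∘ₗ LinearMap.proj i

theorem mem_vanishing_resCoords {p : ι → Fin m → K} {g : Fin s → MvPolynomial (Fin (m + 1)) K} :
    g ∈ vanishing (resCoords K s m) p ↔
      ∀ i k, eval (Fin.cons 0 (p i) : Fin (m + 1) → K) (g k) = 0 := by
  refine forall₂_congr fun i k => ?_
  rw [← eval_res]
  rfl

/-- The first-order condition on tuples `g` with `∑ xₖ gₖ` vanishing to second order at `p` in the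
direction `τ`. -/
noncomputable def tang (p : Fin (r + 1) → K) (τ : Fin r → K) :
    (Fin (r + 1) → MvPolynomial (Fin (r + 2)) K) →ₗ[K] K :=
  ∑ k, p k • dirDeriv (Fin.cons 0 p : Fin (r + 2) → K) (Fin.cons 0 (Fin.cons 0 τ)) ∘ₗ
    LinearMap.proj k

theorem tang_apply (p : Fin (r + 1) → K) (τ : Fin r → K) (g) :
    tang p τ g = ∑ k, p k * dirDeriv (Fin.cons 0 p : Fin (r + 2) → K)
      (Fin.cons 0 (Fin.cons 0 τ)) (g k) := by
  simp [tang]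

/-- The tuples of forms vanishing at points `u` and at points `p` of `x₀ = 0`. -/
noncomputable def tuplesAt (s d : ℕ) (u : κ → Fin (m + 1) → K) (p : ι → Fin m → K) :
    Submodule K (Fin s → MvPolynomial (Fin (m + 1)) K) :=
  formTuples K s (m + 1) d ⊓ vanishing (coords K s (m + 1)) u ⊓ vanishing (resCoords K s m) p

instance (u : κ → Fin (m + 1) → K) (p : ι → Fin m → K) : FiniteDimensional K (tuplesAt s d u p) :=
  Submodule.finiteDimensional_inf_left _ _

instance {M : Type} [AddCommGroup M] [Module K M] (A B : Submodule K M)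
    [FiniteDimensional K A] : FiniteDimensional K ↥(A ⊓ B) :=
  Submodule.finiteDimensional_inf_left _ _

theorem mem_tuplesAt {u : κ → Fin (m + 1) → K} {p : ι → Fin m → K}
    {g : Fin s → MvPolynomial (Fin (m + 1)) K} :
    g ∈ tuplesAt s d u p ↔
      ∀ k, g k ∈ formsAt d p ⊓ vanishing (fun _ : Unit => LinearMap.id) u := by
  simp only [tuplesAt, formsAt, Submodule.mem_inf, mem_formTuples, mem_vanishing,
    LinearMap.proj_apply, LinearMap.id_apply, forall_const, LinearMap.comp_apply,
    AlgHom.toLinearMap_apply]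
  exact ⟨fun h k => ⟨⟨h.1.1 k, fun i => h.2 i k⟩, fun i => h.1.2 i k⟩,
    fun h => ⟨⟨fun k => (h k).1.1, fun i k => (h k).2 i⟩, fun i k => (h k).1.2 i⟩⟩

theorem tuplesAt_eq_pi (u : κ → Fin (m + 1) → K) (p : ι → Fin m → K) :
    tuplesAt s d u p = Submodule.pi Set.univ fun _ =>
      formsAt d p ⊓ vanishing (fun _ : Unit => LinearMap.id) u := by
  ext g
  rw [mem_tuplesAt]
  simp [Submodule.mem_pi]

theorem finrank_tuplesAt (u : κ → Fin (m + 1) → K) (p : ι → Fin m → K) :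
    finrank K (tuplesAt s d u p) =
      s * finrank K ↥(formsAt d p ⊓ vanishing (fun _ : Unit => LinearMap.id) u) := by
  rw [tuplesAt_eq_pi, finrank_pi_const]

theorem finrank_tuplesAt_inf_tang_le (u : κ → Fin (r + 2) → K) (p : ι → Fin (r + 1) → K)
    (i : ι) (hi : p i 0 ≠ 0) :
    finrank K ↥(tuplesAt (r + 1) d u p ⊓
        ⨅ l : Fin r, LinearMap.ker (tang (p i) (Pi.single l 1))) ≤
      r * finrank K ↥(formsAt d p ⊓ vanishing (fun _ : Unit => LinearMap.id) u) +
        finrank K ↥(formsSing d p i ⊓ vanishing (fun _ : Unit => LinearMap.id) u) := by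
  set S := tuplesAt (r + 1) d u p ⊓ ⨅ l : Fin r, LinearMap.ker (tang (p i) (Pi.single l 1))
  let f : S →ₗ[K] Fin r → MvPolynomial (Fin (r + 2)) K :=
    LinearMap.funLeft K _ Fin.succ ∘ₗ S.subtype
  rw [← LinearMap.finrank_range_add_finrank_ker f, ← finrank_tuplesAt (s := r)]
  refine add_le_add (Submodule.finrank_mono ?_) ?_
  · rintro _ ⟨g, rfl⟩
    exact mem_tuplesAt.2 fun k => mem_tuplesAt.1 g.2.1 k.succ
  · have hf : ∀ g : LinearMap.ker f, ∀ k : Fin r, g.1.1 k.succ = 0 := fun g k => congrFun g.2 k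
    refine LinearMap.finrank_le_finrank_of_injective (f := LinearMap.codRestrict
      (formsSing d p i ⊓ vanishing (fun _ : Unit => LinearMap.id) u)
      (LinearMap.proj 0 ∘ₗ S.subtype ∘ₗ Submodule.subtype _) fun g => ?_) fun g g' h => ?_
    · have h0 := mem_tuplesAt.1 g.1.2.1 0
      refine ⟨⟨h0.1, (Submodule.mem_iInf _).2 fun l => ?_⟩, h0.2⟩
      have h1 := LinearMap.mem_ker.1 ((Submodule.mem_iInf _).1 g.1.2.2 l)
      rw [tang_apply, Fin.sum_univ_succ] at h1
      simp only [hf, map_zero, mul_zero, Finset.sum_const_zero, add_zero] at h1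
      exact (mul_eq_zero.1 h1).resolve_left hi
    · have h0 : g.1.1 0 = g'.1.1 0 := congrArg (Submodule.subtype _) h
      refine Subtype.ext (Subtype.ext (funext fun k => ?_))
      cases k using Fin.cases with
      | zero => exact h0
      | succ k => rw [hf, hf]

theorem finrank_le_card_add [Fintype ι] {M : Type} [AddCommGroup M] [Module K M]
    (W : Submodule K M) [FiniteDimensional K W] (P : M →ₗ[K] MvPolynomial (Fin m) K)
    (q : ι → Fin m → K) : finrank K W ≤
      Fintype.card ι + finrank K ↥(W ⊓ vanishing (fun _ : Unit => P) q) := by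
  let f : W →ₗ[K] ι → K := LinearMap.pi fun i => (aeval (q i)).toLinearMap ∘ₗ P ∘ₗ W.subtype
  rw [← LinearMap.finrank_range_add_finrank_ker f]
  refine add_le_add ((Submodule.finrank_le _).trans (by simp)) ?_
  refine LinearMap.finrank_le_finrank_of_injective
    (f := LinearMap.codRestrict _ (W.subtype ∘ₗ Submodule.subtype _) fun v =>
      ⟨v.1.2, fun i _ => congrFun v.2 i⟩) fun v w h => ?_
  exact Subtype.ext (Subtype.ext (congrArg (Submodule.subtype
    (W ⊓ vanishing (fun _ : Unit => P) q)) h))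

theorem eventually_finrank_residual_le_zero [Infinite K] [Finite κ] {ι' : Type}
    (p : Fin j → Fin (r + 1) → K)
    (u : κ → Fin (r + 2) → K) (z : ι' → Fin (r + 1) → K) (q : Fin (r + 1) → K)
    (I : Submodule K (Fin (r + 1) → K)) (hI : finrank K I ≤ j)
    (h1 : finrank K ↥(tuplesAt (r + 1) d u p ⊓ vanishing (fun _ : Unit => psi K (r + 1)) z ⊓
      LinearMap.ker (evalTuple (r + 1) (Fin.cons 0 q : Fin (r + 2) → K))) ≤ 0)
    (h2 : ∀ i, finrank K ↥(tuplesAt (r + 1) d u p ⊓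
      (⨅ l : Fin r, LinearMap.ker (tang (p i) (Pi.single l 1))) ⊓
      vanishing (fun _ : Unit => psi K (r + 1)) z) ≤ 0) :
    ∀ᶠ x in genericPts K (κ ⊕ Fin j) (r + 2), finrank K ↥(formTuples K (r + 1) (r + 2) d ⊓
      (vanishing (fun _ : Unit => psi K (r + 1)) p ⊓ vanishing (fun _ : Unit => psi K (r + 1)) z ⊓
        I.comap (evalTuple (r + 1) (Fin.cons 0 q : Fin (r + 2) → K))) ⊓
      vanishing (coords K (r + 1) (r + 2)) x) ≤ 0 := by
  have := Fintype.ofFinite κ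
  set e := evalTuple (r + 1) (Fin.cons 0 q : Fin (r + 2) → K) with he
  let Z := tuplesAt (r + 1) d u p ⊓ vanishing (fun _ : Unit => psi K (r + 1)) z ⊓ I.comap e
  have hZ : finrank K Z ≤ j := by
    refine le_trans ?_ hI
    refine LinearMap.finrank_le_finrank_of_injective (f := LinearMap.codRestrict I
      (e ∘ₗ Z.subtype) fun g => g.2.2) ?_
    rw [← LinearMap.ker_eq_bot, LinearMap.ker_eq_bot']
    intro g hg
    have hg1 : e g.1 = 0 := congrArg Subtype.val hg
    have hg2 : g.1 ∈ tuplesAt (r + 1) d u p ⊓ vanishing (fun _ : Unit => psi K (r + 1)) z ⊓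
      LinearMap.ker e := ⟨g.2.1, hg1⟩
    rw [Submodule.finrank_eq_zero.1 (Nat.le_zero.1 h1), Submodule.mem_bot] at hg2
    exact Subtype.ext hg2
  obtain ⟨τ, hτ⟩ := exists_choice_finrank_le Z (fun i τ => tang (p i) τ) 0 fun i D hD h =>
    (Submodule.finrank_mono (t := tuplesAt (r + 1) d u p ⊓
      (⨅ l : Fin r, LinearMap.ker (tang (p i) (Pi.single l 1))) ⊓
      vanishing (fun _ : Unit => psi K (r + 1)) z) fun g hg =>
        ⟨⟨(hD hg).1.1, (Submodule.mem_iInf _).2 fun l => h g hg _⟩, (hD hg).1.2⟩).trans (h2 i)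
  rw [Fintype.card_fin, Nat.sub_eq_zero_of_le hZ, max_self] at hτ
  let v (i : Fin j) : Fin (r + 2) → K := Fin.cons 0 (Fin.cons 0 (τ i))
  let φ : (Fin (r + 1) → MvPolynomial (Fin (r + 2)) K) →ₗ[K]
      Fin j × Fin (r + 1) → Polynomial K :=
    LinearMap.pi fun i => (line (Fin.cons 0 (p i.1)) (v i.1)).toLinearMap ∘ₗ LinearMap.proj i.2
  have hφ : ∀ g i, φ g i = line (Fin.cons 0 (p i.1)) (v i.1) (g i.2) := fun _ _ => rfl
  obtain ⟨ε, hε⟩ := exists_submodule_finrank_eval_le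
    (formTuples K (r + 1) (r + 2) d ⊓ (vanishing (fun _ : Unit => psi K (r + 1)) p ⊓
      vanishing (fun _ : Unit => psi K (r + 1)) z ⊓ I.comap e) ⊓
      vanishing (coords K (r + 1) (r + 2)) u) φ ⊥ (by
    intro g hg hg0 w hw hgw
    have h3 : finrank K ↥(Z ⊓ ⨅ i, LinearMap.ker (tang (p i) (τ i))) ≤ 0 :=
      hτ _ fun g hg => ⟨hg.1, fun i => (Submodule.mem_iInf _).1 hg.2 i⟩
    rw [← Submodule.finrank_eq_zero.1 (Nat.le_zero.1 h3)]
    refine ⟨⟨⟨⟨⟨hg.1.1, hg.2⟩, mem_vanishing_resCoords.2 fun i k => ?_⟩, hg.1.2.1.2⟩,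
      hg.1.2.2⟩, (Submodule.mem_iInf _).2 fun i => ?_⟩
    · have := hg0 (i, k)
      rwa [hφ, coeff_zero_line] at this
    · rw [LinearMap.mem_ker, tang_apply]
      have h4 : eval (p i) (psi K (r + 1) w) = 0 := hw.1.2.1.1 i ()
      rw [eval_psi] at h4
      refine Eq.trans (Finset.sum_congr rfl fun k _ => ?_) h4
      have := hgw (i, k)
      rw [hφ, hφ, coeff_zero_line] at this
      rw [← this]
      rfl)
  refine (eventually_finrank_vanishing_le _ _ (Sum.elim u fun i k =>
    (Fin.cons 0 (p i) : Fin (r + 2) → K) k + ε * v i k)).mono fun x hx => hx.trans ?_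
  refine (hε _ ?_).trans (by simp)
  refine fun g hg => ⟨⟨hg.1, fun i k => hg.2 (Sum.inl i) k⟩, fun i => ?_⟩
  rw [hφ, eval_line]
  exact hg.2 (Sum.inr i.1) i.2
end

section
variable {K : Type} [Field K] {m d r j b s : ℕ} {ι κ : Type}

theorem Bd_of_residual [Infinite K] [Fintype ι] [Fintype κ] (p : ι → Fin m → K)
    (q : Fin m → K) (u : κ → Fin (m + 1) → K) (hu : ∀ i, u i 0 ≠ 0)
    (hC : finrank K ↥(Om K m (d + 1) ⊓ vanishing (coords K m m) p ⊓
      LinearMap.ker (evalTuple m q)) ≤ 0)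
    (hT : finrank K ↥(formTuples K m (m + 1) d ⊓
      (vanishing (fun _ : Unit => psi K m) p ⊓
        vanishing (fun _ : Unit => psi K m) (fun _ : Unit => q) ⊓
        ((Om K m (d + 1) ⊓ vanishing (coords K m m) p).map (evalTuple m q)).comap
          (evalTuple m (Fin.cons 0 q : Fin (m + 1) → K))) ⊓
      vanishing (coords K m (m + 1)) u) ≤ b) :
    Bd K (m + 1) (d + 1) (Fintype.card ι + Fintype.card κ + 1) b := by
  set C := Om K m (d + 1) ⊓ vanishing (coords K m m) p
  set T := formTuples K m (m + 1) d ⊓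
      (vanishing (fun _ : Unit => psi K m) p ⊓
        vanishing (fun _ : Unit => psi K m) (fun _ : Unit => q) ⊓
        (C.map (evalTuple m q)).comap (evalTuple m (Fin.cons 0 q : Fin (m + 1) → K))) ⊓
      vanishing (coords K m (m + 1)) u
  let W := C.prod (formTuples K m (m + 1) d) ⊓
    ((vanishing (fun _ : Unit => psi K m) p).comap (LinearMap.snd K _ _) ⊓
      (vanishing (coords K (m + 1) (m + 1)) u).comap (Phi K m))
  let φ : ((Fin m → MvPolynomial (Fin m) K) × (Fin m → MvPolynomial (Fin (m + 1)) K)) →ₗ[K]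
      Fin (m + 1) → Polynomial K :=
    LinearMap.pi fun k => (line (Fin.cons 0 q) (Fin.cons 1 0)).toLinearMap ∘ₗ
      LinearMap.proj k ∘ₗ Phi K m
  have hφ : ∀ x k, φ x k = line (Fin.cons 0 q) (Fin.cons 1 0) (Phi K m x k) := fun _ _ => rfl
  have hφ0 : ∀ x k, (φ x (Fin.succ k)).coeff 0 = eval q (x.1 k) := by
    intro x k
    rw [hφ, coeff_zero_line, eval_Phi_succ]
    simp
  have hφ1 : ∀ x k, (φ x (Fin.succ k)).coeff 1 =
      eval (Fin.cons 0 q : Fin (m + 1) → K) (x.2 k) := by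
    intro x k
    rw [hφ, Phi_succ, map_add, line_emb, map_mul, line_X, Polynomial.coeff_add,
      Polynomial.mul_coeff_one, coeff_zero_line]
    simp
  obtain ⟨ε, hε⟩ := exists_submodule_finrank_eval_le W φ
    ((⊥ : Submodule K (Fin m → MvPolynomial (Fin m) K)).prod T) (by
      rintro ⟨c, g⟩ ⟨⟨hc, hg⟩, hgp, hcgu⟩ h0 ⟨c', g'⟩ ⟨⟨hc', -⟩, -⟩ h1
      have hc0 : c ∈ C ⊓ LinearMap.ker (evalTuple m q) :=
        ⟨hc, LinearMap.mem_ker.2 (funext fun k => (hφ0 (c, g) k).symm.trans (h0 k.succ))⟩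
      rw [Submodule.finrank_eq_zero.1 (Nat.le_zero.1 hC), Submodule.mem_bot] at hc0
      subst hc0
      refine ⟨Submodule.zero_mem _, ⟨hg, ⟨hgp, fun _ _ => ?_⟩, c', hc', funext fun k => ?_⟩,
        vanishing_of_Phi_zero hu hcgu⟩
      · have := h0 0
        rw [hφ, coeff_zero_line, eval_Phi_zero] at this
        rw [eval_psi]
        simpa using this
      · exact ((hφ1 (0, g) k).symm.trans ((h1 k.succ).trans (hφ0 (c', g') k))).symm)
  refine .of_points (Sum.elim (Sum.elim (fun i => (Fin.cons 0 (p i) : Fin (m + 1) → K)) u)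
    (fun _ : Unit => Fin.cons ε q)) ?_ (by simp)
  refine (finrank_le_of_Phi inf_le_left
    (W ⊓ (vanishing (coords K (m + 1) (m + 1)) (fun _ : Unit => Fin.cons ε q)).comap (Phi K m))
    fun x h1 h2 hx => ⟨⟨⟨⟨h1, fun i k => ?_⟩, h2⟩, fun i _ => ?_, fun i k => ?_⟩,
      fun i k => ?_⟩).trans ((hε _ ?_).trans ?_)
  · have h3 := hx.2 (Sum.inl (Sum.inl i)) k.succ
    simp only [LinearMap.proj_apply] at h3
    rw [eval_Phi_succ] at h3
    simpa using h3
  · have h3 := hx.2 (Sum.inl (Sum.inl i)) 0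
    simp only [LinearMap.proj_apply] at h3
    rw [eval_Phi_zero] at h3
    rw [eval_psi]
    simpa using h3
  · exact hx.2 (Sum.inl (Sum.inr i)) k
  · exact hx.2 (Sum.inr i) k
  · refine fun x hx => ⟨hx.1, fun k => ?_⟩
    rw [hφ, eval_line]
    refine Eq.trans (congrArg (fun y => eval y (Phi K m x k)) (funext fun l => ?_)) (hx.2 () k)
    cases l using Fin.cases <;> simp
  · refine (Submodule.finrank_mono inf_le_right).trans ?_
    rw [finrank_submodule_prod, finrank_bot, zero_add]
    exact hT
end

section
variable {K : Type} [Field K] {m d r j b s : ℕ} {ι κ : Type}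

theorem finrank_forms_pos (m d : ℕ) : 1 ≤ finrank K (forms K (m + 1) d) := by
  induction d with
  | zero => rw [finrank_forms_zero_right]
  | succ d ih => rw [finrank_forms_succ_succ]; omega

theorem le_finrank_forms (m d : ℕ) : m ≤ finrank K (forms K m (d + 1)) := by
  induction m with
  | zero => exact Nat.zero_le _
  | succ m ih =>
    rw [finrank_forms_succ_succ]
    have := finrank_forms_pos (K := K) m d
    omega

theorem mem_vanishing_sumElim {M β : Type} [AddCommGroup M] [Module K M]
    {P : β → M →ₗ[K] MvPolynomial (Fin m) K} {p : ι → Fin m → K} {q : κ → Fin m → K} {v : M} :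
    v ∈ vanishing P (Sum.elim p q) ↔ v ∈ vanishing P p ∧ v ∈ vanishing P q :=
  Sum.forall

set_option maxHeartbeats 1000000 in
theorem Bd_of_residual_of_tangent [Infinite K] {σ ρ u : ℕ} (h1 : Bd K (r + 2) (d + 2) σ ρ)
    (h2 : Bd K (r + 2) (d + 2) (σ + 1) 0) (h3 : Bd K (r + 3) (d + 1) u 0) (hρ : ρ ≤ j)
    (hj : j ≤ r + 1) (hjσ : j ≤ σ) (hjd : j ≤ d + 1)
    (hF1 : (r + 2) * (finrank K (forms K (r + 3) (d + 1)) - (u + j + 1)) ≤ σ - j + b)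
    (hF2 : (r + 1) * (finrank K (forms K (r + 3) (d + 1)) - (u + j)) +
      (finrank K (forms K (r + 3) (d + 1)) - (u + j) - (r + 1)) ≤ σ - j + b + 1) :
    Bd K (r + 3) (d + 2) (σ + u + j + 1) b := by
  set N := finrank K (forms K (r + 3) (d + 1)) with hN
  let R : MvPolynomial (Fin (r + 3)) K →ₗ[K] MvPolynomial (Fin (r + 2)) K :=
    (res K (r + 2)).toLinearMap
  let Q : MvPolynomial (Fin (r + 3)) K →ₗ[K] MvPolynomial (Fin (r + 3)) K := LinearMap.id
  let Ψ : (Fin (r + 2) → MvPolynomial (Fin (r + 3)) K) →ₗ[K] MvPolynomial (Fin (r + 2)) K :=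
    psi K (r + 2)
  have hker : finrank K ↥(forms K (r + 3) (d + 1) ⊓ LinearMap.ker R) ≤ N - (j + 1) := by
    refine finrank_forms_inf_ker_res.trans ?_
    have : N = finrank K (forms K (r + 2) (d + 1)) + finrank K (forms K (r + 2 + 1) d) :=
      finrank_forms_succ_succ (K := K) (r + 2) d
    have := le_finrank_forms (K := K) (r + 2) d
    omega
  -- the points at which the residual points specialise
  obtain ⟨p, ⟨hp0, hp01⟩, ⟨hpq, hpy⟩, hp⟩ := (((eventually_coord_ne_zero (K := K)
    (ι := Fin j) 0).and (eventually_minor_ne_zero (zero_ne_one))).and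
    (((eventually_genericPts_sum (h2.eventually (ι := Fin j ⊕ (Unit ⊕ Fin (σ - j)))
      (by simp; omega))).and (eventually_genericPts_sum (h1.eventually (ι := Fin j ⊕ Fin (σ - j))
      (by simp; omega)))).and
    (eventually_finrank_vanishing_le_max (forms K (r + 3) (d + 1)) R))).exists
  rw [Fintype.card_fin] at hp
  have hp' : finrank K (formsAt (d + 1) p) ≤ N - j := hp.trans (max_le le_rfl (by omega))
  have hsing := finrank_formsSing_le hp0 hp01 (hjd.trans (Nat.le_refl _))
  -- the remaining residual points
  obtain ⟨u₀, ⟨hu0, hu⟩, hu1, hu2, hu3⟩ := (((eventually_coord_ne_zero (K := K)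
    (ι := Fin u) 0).and (h3.eventually (Fintype.card_fin u))).and
    ((eventually_finrank_vanishing_le_sub (formsAt (d + 1) p) Q fun _ _ h => h).and
    ((eventually_finrank_vanishing_le_sub (forms K (r + 3) (d + 1) ⊓ LinearMap.ker R) Q
      fun _ _ h => h).and
    (Filter.eventually_all.2 fun i => eventually_finrank_vanishing_le_sub
      (formsSing (d + 1) p i) Q fun _ _ h => h)))).exists
  rw [Fintype.card_fin] at hu1 hu2
  have hψ : ∀ g ∈ formTuples K (r + 2) (r + 3) (d + 1) ⊓ vanishing (coords K (r + 2) (r + 3)) u₀,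
      psi K (r + 2) g = 0 → g = 0 := fun g hg h0 =>
    psi_injective_of_finrank hu0 hu hg.1 hg.2 h0
  -- the point moved off the hyperplane
  obtain ⟨q, ⟨hq0, hq1⟩, hq2⟩ := (((eventually_genericPts_sum hpq).and
    (eventually_finrank_vanishing_le_max
      (formsAt (d + 1) p ⊓ vanishing (fun _ : Unit => Q) u₀) R)).and
    (Filter.eventually_all.2 fun i => eventually_finrank_vanishing_le_sub
      (tuplesAt (r + 2) (d + 1) u₀ p ⊓
        ⨅ l : Fin (r + 1), LinearMap.ker (tang (p i) (Pi.single l 1))) Ψ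
      fun g hg h0 => hψ g hg.1.1 h0)).exists
  have hq1' : finrank K ↥(formsAt (d + 1) (Sum.elim p q) ⊓ vanishing (fun _ : Unit => Q) u₀) ≤
      N - (u + j + 1) := by
    refine le_trans (Submodule.finrank_mono (t := formsAt (d + 1) p ⊓
      vanishing (fun _ : Unit => Q) u₀ ⊓ vanishing (fun _ : Unit => R) q) fun f hf => ?_)
      (hq1.trans (max_le ?_ ?_))
    · have := mem_vanishing_sumElim.1 hf.1.2
      exact ⟨⟨⟨hf.1.1, this.1⟩, hf.2⟩, this.2⟩
    · rw [Fintype.card_unit]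
      omega
    · refine le_trans (Submodule.finrank_mono (t := forms K (r + 3) (d + 1) ⊓ LinearMap.ker R ⊓
        vanishing (fun _ : Unit => Q) u₀) fun f hf => ⟨⟨hf.1.1.1, hf.2⟩, hf.1.2⟩) (hu2.trans ?_)
      omega
  -- the remaining points of the hyperplane, and `b` auxiliary ones
  obtain ⟨y, ⟨hy1, hy2⟩, hy3, hy4⟩ := ((((tendsto_genericPts_comp (K := K) (m := r + 2)
    (Sum.inl_injective (α := Fin (σ - j)) (β := Fin b))).eventually hq0).and
    ((tendsto_genericPts_comp (K := K) (m := r + 2)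
    (Sum.inl_injective (α := Fin (σ - j)) (β := Fin b))).eventually hpy)).and
    ((eventually_finrank_vanishing_le_sub (tuplesAt (r + 2) (d + 1) u₀ (Sum.elim p q)) Ψ
      fun g hg h0 => hψ g hg.1 h0).and
    (Filter.eventually_all.2 fun i => eventually_finrank_vanishing_le_sub
      (tuplesAt (r + 2) (d + 1) u₀ p ⊓
        (⨅ l : Fin (r + 1), LinearMap.ker (tang (p i) (Pi.single l 1))) ⊓
          vanishing (fun _ : Unit => Ψ) q) Ψ
      fun g hg h0 => hψ g hg.1.1.1 h0))).exists
  let y₀ := y ∘ Sum.inl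
  let C := Om K (r + 2) (d + 2) ⊓ vanishing (coords K (r + 2) (r + 2)) (Sum.elim p y₀)
  have hres := eventually_finrank_residual_le_zero (d := d + 1) p u₀ (Sum.elim q y) (q ())
    (C.map (evalTuple (r + 2) (q ()))) ((Submodule.finrank_map_le _ _).trans (hy2.trans hρ)) (by
      refine le_trans (Submodule.finrank_mono (t := tuplesAt (r + 2) (d + 1) u₀ (Sum.elim p q) ⊓
        vanishing (fun _ : Unit => Ψ) y) fun g hg => ⟨⟨hg.1.1.1, mem_vanishing_sumElim.2 ⟨hg.1.1.2,
          mem_vanishing_resCoords.2 fun i k => congrFun hg.2 k⟩⟩,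
          (mem_vanishing_sumElim.1 hg.1.2).2⟩) (hy3.trans ?_)
      rw [finrank_tuplesAt, Fintype.card_sum, Fintype.card_fin, Fintype.card_fin,
        Nat.sub_eq_zero_of_le ((Nat.mul_le_mul_left _ hq1').trans hF1)]) (by
      intro i
      refine le_trans (Submodule.finrank_mono ?_) ((hy4 i).trans ?_)
      · exact fun g hg => ⟨⟨hg.1, (mem_vanishing_sumElim.1 hg.2).1⟩,
          (mem_vanishing_sumElim.1 hg.2).2⟩
      refine (Nat.sub_le_sub_right (hq2 i) _).trans ?_
      have h4 : finrank K ↥(tuplesAt (r + 2) (d + 1) u₀ p ⊓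
          ⨅ l : Fin (r + 1), LinearMap.ker (tang (p i) (Pi.single l 1))) ≤
          (r + 1) * finrank K ↥(formsAt (d + 1) p ⊓ vanishing (fun _ : Unit => Q) u₀) +
            finrank K ↥(formsSing (d + 1) p i ⊓ vanishing (fun _ : Unit => Q) u₀) :=
        finrank_tuplesAt_inf_tang_le (d := d + 1) u₀ p i (hp0 i)
      have h5 : (r + 1) * finrank K ↥(formsAt (d + 1) p ⊓ vanishing (fun _ : Unit => Q) u₀) ≤
        (r + 1) * (N - (u + j)) := Nat.mul_le_mul_left _ (by omega)
      have h6 := hu3 i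
      have h7 := hsing i
      rw [Fintype.card_fin] at h6
      rw [Fintype.card_sum, Fintype.card_fin, Fintype.card_fin, Fintype.card_unit]
      omega)
  obtain ⟨x, hx0, hx⟩ := ((eventually_coord_ne_zero (K := K) 0).and hres).exists
  have hcard : Fintype.card (Fin j ⊕ Fin (σ - j)) + Fintype.card (Fin u ⊕ Fin j) + 1 =
      σ + u + j + 1 := by
    simp only [Fintype.card_sum, Fintype.card_fin]
    omega
  rw [← hcard]
  refine Bd_of_residual (d := d + 1) (Sum.elim p y₀) (q ()) x hx0
    (le_trans (Submodule.finrank_mono ?_) hy1) ((finrank_le_card_add _ Ψ (y ∘ Sum.inr)).trans ?_)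
  · intro f hf
    have := mem_vanishing_sumElim.1 hf.1.2
    exact ⟨hf.1.1, mem_vanishing_sumElim.2 ⟨this.1, mem_vanishing_sumElim.2
      ⟨fun i k => congrFun hf.2 k, this.2⟩⟩⟩
  · rw [Fintype.card_fin]
    refine Nat.add_le_add_left (le_trans (Submodule.finrank_mono ?_) hx) b
    intro g hg
    have h4 := mem_vanishing_sumElim.1 hg.1.1.2.1.1
    refine ⟨⟨hg.1.1.1, ⟨h4.1, mem_vanishing_sumElim.2 ⟨hg.1.1.2.1.2, ?_⟩⟩, hg.1.1.2.2⟩, hg.1.2⟩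
    rintro (i | i)
    · exact h4.2 i
    · exact hg.2 i
end

section
variable {K : Type} [Field K] {m d k s s' b : ℕ}

theorem finrank_Om_zero_right (m : ℕ) : finrank K (Om K m 0) = 0 := by
  rw [Submodule.finrank_eq_zero, eq_bot_iff]
  intro f hf
  obtain ⟨h1, h2⟩ := mem_Om.1 hf
  have hc : ∀ i, f i = C (coeff 0 (f i)) := fun i => totalDegree_eq_zero_iff_eq_C.1
    (Nat.le_zero.1 ((mem_homogeneousSubmodule _ _).1 (h1 i)).totalDegree_le)
  refine (Submodule.mem_bot K).2 (funext fun j => ?_)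
  have h3 := congrArg (eval (Pi.single j 1)) h2
  simp only [map_sum, map_mul, eval_X, Pi.single_apply, ite_mul, one_mul, zero_mul, map_zero,
    Finset.sum_ite_eq', Finset.mem_univ, if_true] at h3
  rw [hc j, eval_C] at h3
  rw [hc j, h3, C_0, Pi.zero_apply]

theorem le_finrank_forms_two (k d : ℕ) : d + 1 ≤ finrank K (forms K (k + 2) d) := by
  induction k with
  | zero => rw [finrank_forms, Nat.multichoose_two]
  | succ k ih =>
    cases d with
    | zero => rw [finrank_forms_zero_right]
    | succ d => rw [finrank_forms_succ_succ]; omega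

theorem Bd.lower (h : Bd K (m + 1) (d + 1) s b) (hs : s' ≤ s) :
    Bd K (m + 1) (d + 1) s' (b + m * (s - s')) := by
  induction s generalizing b with
  | zero => exact (Nat.le_zero.1 hs) ▸ h.mono_right (Nat.le_add_right _ _)
  | succ s ih =>
    obtain rfl | hs := hs.eq_or_lt
    · exact h.mono_right (Nat.le_add_right _ _)
    · refine (ih h.pred (by omega)).mono_right (le_of_eq ?_)
      rw [Nat.succ_sub (by omega), Nat.mul_succ]
      omega

/-- Any number of general points of `ℙ^m` impose independent conditions on `Om K (m + 1) d` until
the latter is exhausted. -/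
def MaxRank (K : Type) [Field K] (m d : ℕ) : Prop :=
  ∀ s, Bd K (m + 1) d s (finrank K (Om K (m + 1) d) - m * s)

theorem Bd.of_le (h : Bd K (m + 1) (d + 1) s (finrank K (Om K (m + 1) (d + 1)) - m * s))
    (hs : m * s ≤ finrank K (Om K (m + 1) (d + 1))) (hs' : s' ≤ s) :
    Bd K (m + 1) (d + 1) s' (finrank K (Om K (m + 1) (d + 1)) - m * s') := by
  refine (h.lower hs').mono_right ?_
  obtain ⟨t, rfl⟩ := Nat.exists_eq_add_of_le hs'
  rw [Nat.mul_add] at *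
  rw [Nat.add_sub_cancel_left]
  omega

theorem maxRank_one [Infinite K] (d : ℕ) : MaxRank K 1 (d + 1) := fun s => by
  refine (horace_zero (u := s)).mono_right ?_
  have h1 : finrank K (Om K 2 (d + 1)) = finrank K (Om K 1 (d + 1)) + 1 * finrank K (forms K 2 d) :=
    finrank_Om_succ_succ (K := K) 1 d
  have h2 := finrank_Om_one (K := K) (d + 1)
  change finrank K (Om K 1 (d + 1)) + 1 * (finrank K (forms K 2 d) - s) ≤
    finrank K (Om K 2 (d + 1)) - 1 * s
  rw [h1, h2, zero_add, zero_add, ← Nat.mul_sub]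

theorem maxRank_two [Infinite K] (d : ℕ) : MaxRank K 2 d := by
  induction d with
  | zero => exact fun s =>
      (Bd_self s).mono_right (by rw [finrank_Om_zero_right]; exact Nat.zero_le _)
  | succ d ih =>
    have hD : ∀ d, finrank K (forms K 2 d) = d + 1 := fun d => by
      rw [finrank_forms, Nat.multichoose_two]
    have h1 : ∀ d, finrank K (Om K 2 (d + 1)) = d + 1 := fun d => by
      have : finrank K (Om K 2 (d + 1)) =
          finrank K (Om K 1 (d + 1)) + 1 * finrank K (forms K 2 d) :=
        finrank_Om_succ_succ (K := K) 1 d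
      rw [finrank_Om_one, hD] at this
      omega
    have h2 : finrank K (Om K 3 (d + 1)) =
        finrank K (Om K 2 (d + 1)) + 2 * finrank K (forms K 3 d) :=
      finrank_Om_succ_succ (K := K) 2 d
    rw [h1] at h2
    have h3 : d + 2 + finrank K (Om K 3 d) ≤ 2 * finrank K (forms K 3 d) := by
      cases d with
      | zero => rw [finrank_Om_zero_right, finrank_forms_zero_right]
      | succ d =>
        have : finrank K (Om K 3 (d + 1)) + finrank K (forms K 2 (d + 2)) =
          2 * finrank K (forms K 3 (d + 1)) := finrank_Om_add_finrank_forms (K := K) 2 d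
        rw [hD] at this
        omega
    have h4 : ∀ u, finrank K (Om K 3 d) ≤ 2 * u →
        Bd K 3 (d + 1) (d + 1 + u) (finrank K (Om K 3 (d + 1)) - 2 * (d + 1 + u)) := by
      intro u hu
      have h5 : Bd K 2 (d + 1) (d + 1) 0 := (maxRank_one d (d + 1)).mono_right (by
        change finrank K (Om K 2 (d + 1)) - _ ≤ 0
        rw [h1]
        omega)
      have h6 : Bd K 3 d u 0 := (ih u).mono_right (Nat.sub_eq_zero_of_le hu).le
      refine (horace h5 h6).mono_right ?_
      change 0 + (2 * (finrank K (forms K 3 d) - u) - (d + 1)) ≤ _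
      omega
    intro s
    by_cases hs : d + 1 + (finrank K (Om K 3 d) + 1) / 2 ≤ s
    · obtain ⟨t, rfl⟩ := Nat.exists_eq_add_of_le hs
      rw [add_assoc]
      exact h4 _ (by omega)
    · refine (h4 ((finrank K (Om K 3 d) + 1) / 2) (by omega)).of_le ?_ (by omega)
      change _ ≤ finrank K (Om K 3 (d + 1))
      omega

/-- The number of points put on the hyperplane. -/
noncomputable def planePoints (K : Type) [Field K] (k d : ℕ) : ℕ :=
  finrank K (Om K (k + 2) (d + 2)) / (k + 1)

/-- The number of points left in general position. -/
noncomputable def residualPoints (K : Type) [Field K] (k d : ℕ) : ℕ :=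
  finrank K (forms K (k + 3) (d + 1)) - (planePoints K k d + (k + 1)) / (k + 2)

theorem maxRank_succ_of [Infinite K] (h : MaxRank K (k + 1) (d + 2)) (hd : k ≤ d)
    (hu : Bd K (k + 3) (d + 1) (residualPoints K k d - (k + 1)) 0)
    (hu0 : k + 1 ≤ residualPoints K k d) (hσ : (k + 2) * (k + 1) ≤ planePoints K k d)
    (hN : (planePoints K k d + (k + 1)) / (k + 2) ≤ finrank K (forms K (k + 3) (d + 1))) :
    MaxRank K (k + 2) (d + 2) := by
  have hr : finrank K (Om K (k + 3) (d + 2)) = finrank K (Om K (k + 2) (d + 2)) +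
    (k + 2) * finrank K (forms K (k + 3) (d + 1)) := finrank_Om_succ_succ (K := K) (k + 2) (d + 1)
  have hc := Nat.div_add_mod (planePoints K k d + (k + 1)) (k + 2)
  have h1 := h (planePoints K k d)
  have h2 := h (planePoints K k d + 1)
  change Bd K (k + 2) (d + 2) _ (finrank K (Om K (k + 2) (d + 2)) - _) at h1 h2
  have hc' := Nat.mod_lt (planePoints K k d + (k + 1)) (Nat.succ_pos (k + 1))
  have he := Nat.div_add_mod (finrank K (Om K (k + 2) (d + 2))) (k + 1)
  have he' := Nat.mod_lt (finrank K (Om K (k + 2) (d + 2))) (Nat.succ_pos k)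
  unfold residualPoints at hu hu0
  change (k + 1) * planePoints K k d + _ = _ at he
  generalize planePoints K k d = σ at *
  generalize finrank K (Om K (k + 2) (d + 2)) % (k + 1) = ρ at *
  generalize finrank K (Om K (k + 2) (d + 2)) = e at *
  generalize (σ + (k + 1)) % (k + 2) = κ' at *
  generalize hcc : (σ + (k + 1)) / (k + 2) = c at *
  have hck : k + 1 ≤ c := by
    rw [← hcc, Nat.le_div_iff_mul_le (by omega)]
    linarith
  obtain ⟨κ, hκ⟩ : ∃ κ, κ + κ' = k + 1 := ⟨k + 1 - κ', by omega⟩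
  have hκc : (k + 2) * c = σ + κ := by omega
  obtain ⟨u, hN'⟩ := Nat.exists_eq_add_of_le' hN
  have hNu : finrank K (forms K (k + 3) (d + 1)) - c = u := by omega
  rw [hNu] at hu hu0
  have hmul : (k + 2) * finrank K (forms K (k + 3) (d + 1)) = (k + 2) * u + (σ + κ) := by
    rw [hN', Nat.mul_add, hκc]
  have h1' : Bd K (k + 2) (d + 2) σ ρ := h1.mono_right (by omega)
  have h2' : Bd K (k + 2) (d + 2) (σ + 1) 0 := h2.mono_right (by rw [Nat.mul_add]; omega)
  have hsub : ∀ t, (k + 2) * (finrank K (forms K (k + 3) (d + 1)) - (u + t)) =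
      σ + κ - (k + 2) * t := by
    intro t
    rw [Nat.mul_sub, Nat.mul_add, hmul]
    omega
  have key : finrank K (Om K (k + 3) (d + 2)) = (k + 2) * (σ + u) + (ρ + κ) := by
    rw [hr, hmul, ← he]
    ring
  have hA : Bd K (k + 3) (d + 2) (σ + u)
      (finrank K (Om K (k + 3) (d + 2)) - (k + 2) * (σ + u)) := by
    refine (horace h1' (hu.mono_left (Nat.sub_le _ _))).mono_right ?_
    have : (k + 2) * (finrank K (forms K (k + 3) (d + 1)) - u) = σ + κ := by simpa using hsub 0
    change ρ + ((k + 2) * (finrank K (forms K (k + 3) (d + 1)) - u) - σ) ≤ _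
    omega
  intro s
  rcases Nat.lt_trichotomy s (σ + u + 1) with hs | rfl | hs
  · refine hA.of_le ?_ (by omega)
    change (k + 2) * (σ + u) ≤ finrank K (Om K (k + 3) (d + 2))
    omega
  · change Bd K (k + 3) (d + 2) (σ + u + 1)
      (finrank K (Om K (k + 3) (d + 2)) - (k + 2) * (σ + u + 1))
    rw [key, Nat.mul_add (k + 2) (σ + u) 1]
    obtain rfl | hκ0 := Nat.eq_zero_or_pos κ
    · rw [show σ + u + 1 = σ + 1 + u by omega]
      refine (horace h2' (hu.mono_left (Nat.sub_le _ _))).mono_right ?_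
      have : (k + 2) * (finrank K (forms K (k + 3) (d + 1)) - u) = σ + 0 := by simpa using hsub 0
      change 0 + ((k + 2) * (finrank K (forms K (k + 3) (d + 1)) - u) - (σ + 1)) ≤ _
      omega
    · set b := (k + 2) * (σ + u) + (ρ + κ) - ((k + 2) * (σ + u) + (k + 2) * 1) with hb
      obtain ⟨j, hj⟩ : ∃ j, j + κ = k + 2 + b := ⟨k + 2 + b - κ, by omega⟩
      have h5 := hsub 1
      have hju : j ≤ u := by omega
      have hσk : k + 1 ≤ σ := le_trans (Nat.le_mul_of_pos_left _ (by omega)) hσ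
      have h6 : u - j + j = u := by omega
      rw [show σ + u + 1 = σ + (u - j) + j + 1 by omega]
      refine Bd_of_residual_of_tangent h1' h2' (hu.mono_left (by omega)) (by omega) (by omega)
        (by omega) (by omega) ?_ ?_
      · rw [h6, h5]
        omega
      · rw [h6]
        have h7 := hsub 0
        have h8 : (k + 2) * c = (k + 1) * c + c := by ring
        rw [hN', Nat.add_sub_cancel_left]
        omega
  · obtain ⟨t, rfl⟩ := Nat.exists_eq_add_of_le hs
    refine Bd.mono_right (b := 0) ?_ (Nat.zero_le _)
    rw [show (σ + u + 1).succ + t = σ + 1 + (u + 1 + t) by omega]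
    refine (horace h2' (hu.mono_left (by omega))).mono_right ?_
    have := hsub (1 + t)
    change 0 + ((k + 2) * (finrank K (forms K (k + 3) (d + 1)) - (u + 1 + t)) - (σ + 1)) ≤ _
    rw [add_assoc u, this, Nat.mul_add]
    omega

end

section

/-- Monotone properties propagated along steps eventually beat any threshold growing faster. -/
theorem eventually_of_step {P : ℕ → ℕ → Prop} {f g : ℕ → ℕ} {r m d₀ : ℕ}
    (hP : ∀ d u v, P d u → u ≤ v → P d v) (h₀ : ∃ u, P d₀ u) (hr : r < m)
    (hstep : ∀ d ≥ d₀, ∀ u, f d + 1 ≤ u → P d u → P (d + 1) (g d + 1 + u))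
    (hr' : ∀ d ≥ d₀, r ≤ f d) (hf : ∀ d ≥ d₀, f d + g d + m + 2 ≤ f (d + 1)) :
    ∃ d₁ ≥ d₀, ∀ d ≥ d₁, P d (f d - r) := by
  obtain ⟨a, ha⟩ := h₀
  have h : ∀ k, P (d₀ + k) (f (d₀ + k) - r + (a - k)) := by
    intro k
    induction k with
    | zero => exact hP _ _ _ ha (by simp)
    | succ k ih =>
      have h1 : _ ≤ f (d₀ + (k + 1)) := hf (d₀ + k) (Nat.le_add_right _ _)
      have h2 := hr' (d₀ + k) (Nat.le_add_right _ _)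
      exact hP _ _ _ (hstep (d₀ + k) (Nat.le_add_right _ _) (f (d₀ + k) - r + (a - k) + m)
        (by omega) (hP _ _ _ ih (by omega))) (by rw [← add_assoc]; omega)
  refine ⟨d₀ + a, Nat.le_add_right _ _, fun d hd => ?_⟩
  obtain ⟨k, rfl⟩ := Nat.exists_eq_add_of_le hd
  have := h (a + k)
  rwa [← add_assoc, Nat.sub_eq_zero_of_le (Nat.le_add_right a k), add_zero] at this

variable {K : Type} [Field K] {d k : ℕ}

theorem planePoints_le (k d : ℕ) :
    (k + 1) * planePoints K k d + finrank K (forms K (k + 1) (d + 3)) ≤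
      (k + 1) * finrank K (forms K (k + 2) (d + 2)) := by
  have : finrank K (Om K (k + 2) (d + 2)) + finrank K (forms K (k + 1) (d + 3)) =
    (k + 1) * finrank K (forms K (k + 2) (d + 2)) :=
    finrank_Om_add_finrank_forms (K := K) (k + 1) (d + 1)
  have h2 : (k + 1) * planePoints K k d ≤ _ := Nat.mul_div_le _ _
  omega

theorem planePoints_succ_le (k d : ℕ) :
    planePoints K k (d + 1) ≤ planePoints K k d + finrank K (forms K (k + 1) (d + 3)) := by
  have h1 : finrank K (Om K (k + 2) (d + 2)) + finrank K (forms K (k + 1) (d + 3)) =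
    (k + 1) * finrank K (forms K (k + 2) (d + 2)) :=
    finrank_Om_add_finrank_forms (K := K) (k + 1) (d + 1)
  have h2 : finrank K (Om K (k + 2) (d + 3)) + finrank K (forms K (k + 1) (d + 4)) =
    (k + 1) * finrank K (forms K (k + 2) (d + 3)) :=
    finrank_Om_add_finrank_forms (K := K) (k + 1) (d + 2)
  have h3 : finrank K (forms K (k + 2) (d + 3)) =
    finrank K (forms K (k + 1) (d + 3)) + finrank K (forms K (k + 2) (d + 2)) :=
    finrank_forms_succ_succ (K := K) (k + 1) (d + 2)
  have h4 : finrank K (forms K (k + 1) (d + 4)) =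
    finrank K (forms K k (d + 4)) + finrank K (forms K (k + 1) (d + 3)) :=
    finrank_forms_succ_succ (K := K) k (d + 3)
  rw [planePoints, planePoints, ← Nat.add_mul_div_left _ _ k.succ_pos]
  refine Nat.div_le_div_right ?_
  change finrank K (Om K (k + 2) (d + 3)) ≤ _
  rw [h3, Nat.mul_add] at h2
  change _ ≤ _ + (k + 1) * _
  omega

theorem le_planePoints (k d : ℕ) : d + 2 ≤ planePoints K k d := by
  have h1 : finrank K (Om K (k + 2) (d + 2)) = finrank K (Om K (k + 1) (d + 2)) +
    (k + 1) * finrank K (forms K (k + 2) (d + 1)) := finrank_Om_succ_succ (K := K) (k + 1) (d + 1)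
  refine (le_finrank_forms_two (K := K) k (d + 1)).trans ?_
  rw [planePoints, Nat.le_div_iff_mul_le k.succ_pos, mul_comm]
  exact h1 ▸ Nat.le_add_left _ _

theorem planePoints_le_finrank (k d : ℕ) :
    planePoints K k d ≤ (k + 2) * finrank K (forms K (k + 3) (d + 1)) := by
  have h1 := planePoints_le (K := K) k d
  have h2 : finrank K (Om K (k + 3) (d + 1)) + finrank K (forms K (k + 2) (d + 2)) =
    (k + 2) * finrank K (forms K (k + 3) (d + 1)) :=
    finrank_Om_add_finrank_forms (K := K) (k + 2) d
  have h3 := Nat.le_of_mul_le_mul_left ((Nat.le_add_right _ _).trans h1) k.succ_pos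
  omega

theorem planePoints_ceil_le (k d : ℕ) :
    (planePoints K k d + (k + 1)) / (k + 2) ≤ finrank K (forms K (k + 3) (d + 1)) := by
  have := planePoints_le_finrank (K := K) k d
  rw [Nat.div_le_iff_le_mul_add_pred (by omega)]
  omega

theorem residualPoints_succ
    (h : (k + 1) * (k + 2) * (k + 5) ≤ finrank K (forms K (k + 1) (d + 3))) :
    residualPoints K k d + planePoints K k d + (k + 2) + 2 ≤ residualPoints K k (d + 1) := by
  have h1 := planePoints_le (K := K) k d
  have h2 := planePoints_succ_le (K := K) k d
  have h3 := planePoints_ceil_le (K := K) k d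
  have h4 := planePoints_ceil_le (K := K) k (d + 1)
  have h5 : finrank K (forms K (k + 3) (d + 2)) =
    finrank K (forms K (k + 2) (d + 2)) + finrank K (forms K (k + 3) (d + 1)) :=
    finrank_forms_succ_succ (K := K) (k + 2) (d + 1)
  have h6 := Nat.div_mul_le_self (planePoints K k (d + 1) + (k + 1)) (k + 2)
  have h7 := Nat.div_add_mod (planePoints K k d + (k + 1)) (k + 2)
  have h8 : _ < k + 2 := Nat.mod_lt (planePoints K k d + (k + 1)) (Nat.succ_pos (k + 1))
  unfold residualPoints
  change _ ≤ finrank K (forms K (k + 3) (d + 2)) - _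
  change _ ≤ finrank K (forms K (k + 3) (d + 2)) at h4
  generalize planePoints K k d = σ at *
  generalize planePoints K k (d + 1) = σ' at *
  generalize (σ + (k + 1)) / (k + 2) = c at *
  generalize (σ' + (k + 1)) / (k + 2) = c' at *
  generalize finrank K (forms K (k + 1) (d + 3)) = Q at *
  generalize finrank K (forms K (k + 2) (d + 2)) = D at *
  have key : c' + σ + (k + 4) ≤ D + c := by
    have h9 : (k + 2) * c' ≤ (k + 2) * c + Q + (k + 1) := by
      have : σ ≤ (k + 2) * c := by omega
      nlinarith
    refine Nat.le_of_mul_le_mul_left (c := (k + 1) * (k + 2)) ?_ (by positivity)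
    nlinarith
  omega

theorem eventually_maxRank_succ [Infinite K] (k : ℕ) {d₀ : ℕ}
    (h : ∀ d ≥ d₀, MaxRank K (k + 2) d) : ∃ d₁, ∀ d ≥ d₁, MaxRank K (k + 3) d := by
  have hf : ∀ d ≥ (k + 2) * (k + 3) * (k + 6), residualPoints K (k + 1) d +
      planePoints K (k + 1) d + (k + 3) + 2 ≤ residualPoints K (k + 1) (d + 1) := fun d hd =>
    residualPoints_succ (hd.trans (by
      have : d + 3 + 1 ≤ finrank K (forms K (k + 2) (d + 3)) := le_finrank_forms_two k (d + 3)
      change d ≤ finrank K (forms K (k + 2) (d + 3))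
      omega))
  have hr : ∀ d ≥ d₀ + (k + 2) * (k + 3) * (k + 6) + 1, k + 2 ≤ residualPoints K (k + 1) d := by
    intro d hd
    obtain ⟨d, rfl⟩ : ∃ d', d = d' + 1 := ⟨d - 1, by omega⟩
    have := hf d (by omega)
    omega
  obtain ⟨d₁, hd₁, H⟩ := eventually_of_step (P := fun d u => Bd K (k + 4) (d + 1) u 0)
    (f := residualPoints K (k + 1)) (g := planePoints K (k + 1)) (r := k + 2) (m := k + 3)
    (d₀ := d₀ + (k + 2) * (k + 3) * (k + 6) + 1) (fun d u v => Bd.mono_left) exists_Bd_zero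
    (Nat.lt_succ_self _) (by
      intro d hd u hu hB
      have h1 : Bd K (k + 3) (d + 2) (planePoints K (k + 1) d + 1) 0 :=
        (h (d + 2) (by omega) _).mono_right (Nat.sub_eq_zero_of_le
          (Nat.lt_mul_div_succ (finrank K (Om K (k + 3) (d + 2))) (k + 1).succ_pos).le).le
      refine (horace h1 hB).mono_right ?_
      change 0 + ((k + 3) * (finrank K (forms K (k + 4) (d + 1)) - u) - (_ + 1)) ≤ 0
      have h2 := planePoints_ceil_le (K := K) (k + 1) d
      have h3 := Nat.div_mul_le_self (planePoints K (k + 1) d + (k + 2)) (k + 3)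
      rw [residualPoints] at hu
      change finrank K (forms K (k + 4) (d + 1)) -
        (planePoints K (k + 1) d + (k + 2)) / (k + 3) + 1 ≤ u at hu
      change (planePoints K (k + 1) d + (k + 2)) / (k + 3) ≤
        finrank K (forms K (k + 4) (d + 1)) at h2
      have h4 : (k + 3) * (finrank K (forms K (k + 4) (d + 1)) - u) ≤
          (planePoints K (k + 1) d + (k + 2)) / (k + 3) * (k + 3) - (k + 3) := by
        rw [← Nat.sub_one_mul, mul_comm]
        exact Nat.mul_le_mul_right _ (by omega)
      omega) hr (fun d hd => hf d (by omega))
  refine ⟨d₁ + 2, fun d hd => ?_⟩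
  obtain ⟨d, rfl⟩ := Nat.exists_eq_add_of_le' ((Nat.le_add_left 2 d₁).trans hd)
  have h1 : (k + 2) * (k + 3) ≤ (k + 2) * (k + 3) * (k + 6) := Nat.le_mul_of_pos_right _ (by omega)
  have h2 : k + 2 ≤ (k + 2) * (k + 3) := Nat.le_mul_of_pos_right _ (by omega)
  have h3 := le_planePoints (K := K) (k + 1) d
  refine maxRank_succ_of (h _ (by omega)) (by omega) (H d (by omega)) (hr d (by omega)) ?_
    (planePoints_ceil_le _ _)
  change (k + 3) * (k + 2) ≤ _
  rw [mul_comm]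
  omega

theorem eventually_maxRank [Infinite K] (k : ℕ) : ∃ d₀, ∀ d ≥ d₀, MaxRank K (k + 2) d := by
  induction k with
  | zero => exact ⟨0, fun d _ => maxRank_two d⟩
  | succ k ih => exact ih.elim fun _ => eventually_maxRank_succ k

end

section
variable {K : Type} [Field K] {nn : ℕ}

theorem omegaSec_succ (d : ℕ) : omegaSec K nn (d + 1) = Om K (nn + 1) d := by
  ext f
  rw [mem_Om]
  exact and_congr_left' (by simp [forms])

theorem h0OmS_succ {s : ℕ} (T : Fin s → PtPn K nn) (d : ℕ) :
    h0OmS K nn T (d + 1) = finrank K ↥(Om K (nn + 1) d ⊓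
      vanishing (coords K (nn + 1) (nn + 1)) fun i => (T i).P) := by
  rw [← omegaSec_succ]
  have hmem : ∀ w : SubT (omegaSec K nn (d + 1)), w ∈ secOmPts K nn T (d + 1) ↔
      ∀ i j, eval (T i).P (w.val j) = 0 := fun w => by
    rw [secOmPts, Submodule.mem_iInf]
    exact forall_congr' fun i => funext_iff
  exact LinearEquiv.finrank_eq (R := K)
    { toFun := fun x => ⟨x.1.1, x.1.2, (hmem x.1).1 x.2⟩
      invFun := fun x => ⟨⟨x.1, x.2.1⟩, (hmem ⟨x.1, x.2.1⟩).2 x.2.2⟩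
      map_add' := fun _ _ => rfl
      map_smul' := fun _ _ => rfl
      left_inv := fun _ => rfl
      right_inv := fun _ => rfl }

end

/-- Lemma `ee1`.
Fix an integer `n ≥ 2` (over an algebraically closed field `K` of characteristic `0`).
Then there exists an integer `t(n)` such that for all integers `t ≥ t(n)` and all `s ∈ ℕ`,
if `S` is a general subset of `ℙ^n` of cardinality `s`, then either
`h^1(ℙ^n, 𝓘_S ⊗ Ω^1_{ℙ^n}(t)) = 0` or `h^0(ℙ^n, 𝓘_S ⊗ Ω^1_{ℙ^n}(t)) = 0`. -/
theorem statement13 (K : Type) [Field K] [IsAlgClosed K] [CharZero K]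
    (nn : ℕ) (hnn : 2 ≤ nn) :
    ∃ tn : ℕ, ∀ t : ℕ, tn ≤ t → ∀ s : ℕ,
      GenericPtsPn K nn s (fun T => h1OmS K nn T t = 0 ∨ h0OmS K nn T t = 0) := by
  obtain ⟨k, rfl⟩ := Nat.exists_eq_add_of_le' hnn
  obtain ⟨d₀, h⟩ := eventually_maxRank (K := K) k
  refine ⟨d₀ + 2, fun t ht s => ?_⟩
  obtain ⟨d, rfl⟩ := Nat.exists_eq_add_of_le' ((Nat.le_add_left 2 d₀).trans ht)
  obtain ⟨F, hF, H⟩ := (h (d + 1) (by omega) s).eventually (Fintype.card_fin s)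
  refine ⟨F, hF, fun T hT => ?_⟩
  have h1 : h0OmS K (k + 2) T (d + 2) ≤ h0Omega K (k + 2) (d + 2) - (k + 2) * s := by
    rw [h0OmS_succ, h0Omega, omegaSec_succ]
    exact H (fun i => (T i).P) hT
  have h2 : h0Omega K (k + 2) (d + 2) ≤ h0OmS K (k + 2) T (d + 2) + (k + 2) * s := by
    rw [h0OmS_succ, h0Omega, omegaSec_succ]
    exact finrank_Om_le_add_mul _
  change h1OmS K (k + 2) T (d + 2) = 0 ∨ h0OmS K (k + 2) T (d + 2) = 0
  rw [h1OmS]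
  zify at h2
  obtain h3 | h3 := le_total ((k + 2) * s) (h0Omega K (k + 2) (d + 2))
  · left
    zify [h3] at h1
    push_cast
    omega
  · right
    omega

end MultiProjPaper
end
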